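/- A Finsler metric F on an open set U ⊆ ℝⁿ (n ≥ 2) is of sectional flag curvature if and only if for every x ∈ U, every y ∈ ℝⁿ ∖ {0} and every v ∈ ℝⁿ the identity (C_{ijm}v^iv^j R^m_k v^k − C_{ijk|0|0}v^iv^jv^k) · (h_{pq}v^pv^q) = 2(C_{ijk}v^iv^jv^k)(R_{pq}v^pv^q) holds, all tensors being evaluated at (x, y). -/

import Mathlib

open scoped BigOperators
open MeasureTheory

noncomputable section

namespace Paper

/-- `E n` is the model space ℝⁿ. -/
abbrev E (n : ℕ) := Fin n → ℝ

/-- `e n i` is the `i`-th standard basis vector of ℝⁿ. -/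
def e (n : ℕ) (i : Fin n) : E n := Pi.single i 1

/-- Partial derivative of `f(x,y)` in the fiber variable `y^i`. -/
def pdy (n : ℕ) (f : E n → E n → ℝ) (i : Fin n) : E n → E n → ℝ :=
  fun x y => fderiv ℝ (f x) y (e n i)

/-- Partial derivative of `f(x,y)` in the base variable `x^k`. -/
def pdx (n : ℕ) (f : E n → E n → ℝ) (k : Fin n) : E n → E n → ℝ :=
  fun x y => fderiv ℝ (fun x' => f x' y) x (e n k)

/-- The square `F²` of the metric. -/
def F2 (n : ℕ) (F : E n → E n → ℝ) : E n → E n → ℝ := fun x y => (F x y) ^ 2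

/-- Fundamental tensor `g_{ij} = ½ [F²]_{y^i y^j}`. -/
def gm (n : ℕ) (F : E n → E n → ℝ) (i j : Fin n) : E n → E n → ℝ :=
  fun x y => (1 / 2 : ℝ) * pdy n (pdy n (F2 n F) j) i x y

/-- The fundamental tensor as a matrix. -/
def gmat (n : ℕ) (F : E n → E n → ℝ) (x y : E n) : Matrix (Fin n) (Fin n) ℝ :=
  Matrix.of fun i j => gm n F i j x y

/-- The inverse fundamental tensor `g^{ij}`. -/
def ginv (n : ℕ) (F : E n → E n → ℝ) (x y : E n) : Matrix (Fin n) (Fin n) ℝ :=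
  (gmat n F x y)⁻¹

/-- `F_{y^i}`. -/
def Fy (n : ℕ) (F : E n → E n → ℝ) (i : Fin n) : E n → E n → ℝ := pdy n F i

/-- Angular metric `h_{ij} = g_{ij} - F_{y^i} F_{y^j}`. -/
def hm (n : ℕ) (F : E n → E n → ℝ) (i j : Fin n) : E n → E n → ℝ :=
  fun x y => gm n F i j x y - Fy n F i x y * Fy n F j x y

/-- Cartan tensor `C_{ijk} = ¼ [F²]_{y^i y^j y^k}`. -/
def Cartan (n : ℕ) (F : E n → E n → ℝ) (i j k : Fin n) : E n → E n → ℝ :=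
  fun x y => (1 / 4 : ℝ) * pdy n (pdy n (pdy n (F2 n F) k) j) i x y

/-- Mean Cartan tensor `I_i = g^{jk} C_{ijk}`. -/
def meanCartan (n : ℕ) (F : E n → E n → ℝ) (i : Fin n) : E n → E n → ℝ :=
  fun x y => ∑ j, ∑ k, ginv n F x y j k * Cartan n F i j k x y

/-- Matsumoto torsion `M_{ijk}`. -/
def Matsumoto (n : ℕ) (F : E n → E n → ℝ) (i j k : Fin n) : E n → E n → ℝ :=
  fun x y => Cartan n F i j k x y -
    (1 / ((n : ℝ) + 1)) * (hm n F i j x y * meanCartan n F k x y +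
      hm n F j k x y * meanCartan n F i x y + hm n F k i x y * meanCartan n F j x y)

/-- Spray coefficients `G^i = ¼ g^{il} ([F²]_{x^k y^l} y^k - [F²]_{x^l})`. -/
def Spray (n : ℕ) (F : E n → E n → ℝ) (i : Fin n) : E n → E n → ℝ :=
  fun x y => (1 / 4 : ℝ) * ∑ l, ginv n F x y i l *
    ((∑ k, pdx n (pdy n (F2 n F) l) k x y * y k) - pdx n (F2 n F) l x y)

/-- Riemann curvature `R^i_k`. -/
def RiemUp (n : ℕ) (F : E n → E n → ℝ) (i k : Fin n) : E n → E n → ℝ :=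
  fun x y =>
    2 * pdx n (Spray n F i) k x y
    - (∑ j, y j * pdx n (pdy n (Spray n F i) k) j x y)
    + 2 * (∑ j, Spray n F j x y * pdy n (pdy n (Spray n F i) k) j x y)
    - ∑ j, pdy n (Spray n F i) j x y * pdy n (Spray n F j) k x y

/-- Riemann curvature with lowered index `R_{jk} = g_{ij} R^i_k`. -/
def Rlow (n : ℕ) (F : E n → E n → ℝ) (j k : Fin n) : E n → E n → ℝ :=
  fun x y => ∑ i, gm n F i j x y * RiemUp n F i k x y

/-- Flag curvature `K(x,y,v)`. -/
def K (n : ℕ) (F : E n → E n → ℝ) (x y v : E n) : ℝ :=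
  (∑ j, ∑ k, Rlow n F j k x y * v j * v k) /
    ((F x y) ^ 2 * ∑ j, ∑ k, hm n F j k x y * v j * v k)

/-- `F` is a Finsler metric on the open set `U ⊆ ℝⁿ`. -/
structure IsFinsler (n : ℕ) (U : Set (E n)) (F : E n → E n → ℝ) : Prop where
  smooth : ContDiffOn ℝ (⊤ : ℕ∞) (fun p : E n × E n => F p.1 p.2) (U ×ˢ {y : E n | y ≠ 0})
  pos : ∀ x ∈ U, ∀ y : E n, y ≠ 0 → 0 < F x y
  homog : ∀ x ∈ U, ∀ y : E n, y ≠ 0 → ∀ c : ℝ, 0 < c → F x (c • y) = c * F x y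
  posdef : ∀ x ∈ U, ∀ y : E n, y ≠ 0 → (gmat n F x y).PosDef

/-- `F` is of sectional flag curvature: `K` only depends on the section. -/
def SectionalFlagCurv (n : ℕ) (U : Set (E n)) (F : E n → E n → ℝ) : Prop :=
  ∀ x ∈ U, ∀ y v y' v' : E n,
    LinearIndependent ℝ ![y, v] → LinearIndependent ℝ ![y', v'] →
    Submodule.span ℝ {y, v} = Submodule.span ℝ {y', v'} →
    K n F x y v = K n F x y' v'

/-- The flag curvature is isotropic at `x`. -/
def IsotropicAt (n : ℕ) (F : E n → E n → ℝ) (x : E n) : Prop :=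
  ∃ c : ℝ, ∀ y v : E n, LinearIndependent ℝ ![y, v] → K n F x y v = c

/-- The spray vector field `G = y^i ∂/∂x^i - 2G^i ∂/∂y^i` acting on a function of `(x,y)`. -/
def Gop (n : ℕ) (F f : E n → E n → ℝ) : E n → E n → ℝ :=
  fun x y => (∑ i, y i * pdx n f i x y) - 2 * ∑ i, Spray n F i x y * pdy n f i x y

/-- Dynamical derivative of a 1-index tensor. -/
def Dyn1 (n : ℕ) (F : E n → E n → ℝ) (T : Fin n → E n → E n → ℝ) (i : Fin n) :
    E n → E n → ℝ :=
  fun x y => Gop n F (T i) x y - ∑ m, pdy n (Spray n F m) i x y * T m x y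

/-- Dynamical derivative of a 2-index tensor. -/
def Dyn2 (n : ℕ) (F : E n → E n → ℝ) (T : Fin n → Fin n → E n → E n → ℝ) (i j : Fin n) :
    E n → E n → ℝ :=
  fun x y => Gop n F (T i j) x y - (∑ m, pdy n (Spray n F m) i x y * T m j x y)
    - ∑ m, pdy n (Spray n F m) j x y * T i m x y

/-- Dynamical derivative of a 3-index tensor. -/
def Dyn3 (n : ℕ) (F : E n → E n → ℝ) (T : Fin n → Fin n → Fin n → E n → E n → ℝ)
    (i j k : Fin n) : E n → E n → ℝ :=
  fun x y => Gop n F (T i j k) x y - (∑ m, pdy n (Spray n F m) i x y * T m j k x y)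
    - (∑ m, pdy n (Spray n F m) j x y * T i m k x y)
    - ∑ m, pdy n (Spray n F m) k x y * T i j m x y

/-- `y` is a polar direction at `x`: `R_{jk} = κ F² h_{jk}` for some constant `κ`. -/
def IsPolarDir (n : ℕ) (F : E n → E n → ℝ) (x y : E n) : Prop :=
  ∃ κ : ℝ, ∀ j k : Fin n, Rlow n F j k x y = κ * (F x y) ^ 2 * hm n F j k x y


/-- The space of triples `(x, y, v)`. -/
abbrev M (n : ℕ) := E n × E n × E n

/-- Smoothness on a set. -/
def Sm {A W : Type*} [NormedAddCommGroup A] [NormedSpace ℝ A] [NormedAddCommGroup W]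
    [NormedSpace ℝ W] (s : Set A) (φ : A → W) : Prop :=
  ContDiffOn ℝ (⊤ : ℕ∞) φ s

/-- Derivative of `φ` along the vector field `X`. -/
def L {A W : Type*} [NormedAddCommGroup A] [NormedSpace ℝ A] [NormedAddCommGroup W]
    [NormedSpace ℝ W] (X : A → A) (φ : A → W) : A → W :=
  fun m => fderiv ℝ φ m (X m)

section ops

variable {A W : Type*} [NormedAddCommGroup A] [NormedSpace ℝ A] [NormedAddCommGroup W]
    [NormedSpace ℝ W] {s : Set A}

theorem Sm.at {φ : A → W} (h : Sm s φ) (hs : IsOpen s) {m : A} (hm : m ∈ s) :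
    ContDiffAt ℝ (⊤ : ℕ∞) φ m := ContDiffOn.contDiffAt h (hs.mem_nhds hm)

theorem Sm.diff {φ : A → W} (h : Sm s φ) (hs : IsOpen s) {m : A} (hm : m ∈ s) :
    DifferentiableAt ℝ φ m := (h.at hs hm).differentiableAt (by simp)

theorem Sm.fd {φ : A → W} (h : Sm s φ) (hs : IsOpen s) : Sm s (fderiv ℝ φ) :=
  ContDiffOn.fderiv_of_isOpen h hs (by simp)

theorem Sm.L {φ : A → W} {X : A → A} (h : Sm s φ) (hX : Sm s X) (hs : IsOpen s) :
    Sm s (L X φ) :=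
  ContDiffOn.clm_apply (h.fd hs) hX

theorem L_congr (hs : IsOpen s) {φ ψ : A → W} (X : A → A) (h : ∀ m ∈ s, φ m = ψ m) :
    ∀ m ∈ s, L X φ m = L X ψ m := by
  intro m hm
  have : φ =ᶠ[nhds m] ψ := Filter.eventually_of_mem (hs.mem_nhds hm) h
  simp only [L, this.fderiv_eq]

theorem L_L {φ : A → W} {X Y : A → A} (h : Sm s φ) (hY : Sm s Y) (hs : IsOpen s)
    {m : A} (hm : m ∈ s) :
    L X (L Y φ) m = fderiv ℝ (fderiv ℝ φ) m (X m) (Y m) + fderiv ℝ φ m (L X Y m) := by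
  have h1 := ((h.fd hs).diff hs hm)
  have h2 := hY.diff hs hm
  have : fderiv ℝ (L Y φ) m = _ := fderiv_clm_apply h1 h2
  rw [L, this]
  simp [L, add_comm]

theorem L_comm {φ : A → W} {X Y : A → A} (h : Sm s φ) (hX : Sm s X) (hY : Sm s Y)
    (hs : IsOpen s) {m : A} (hm : m ∈ s) :
    L X (L Y φ) m = L Y (L X φ) m + fderiv ℝ φ m (L X Y m - L Y X m) := by
  have h1 : IsSymmSndFDerivAt ℝ φ m :=
    (h.at hs hm).isSymmSndFDerivAt (by simp; exact WithTop.coe_le_coe.2 (le_top : (2 : ℕ∞) ≤ ⊤))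
  rw [L_L h hY hs hm, L_L h hX hs hm, h1.eq (X m) (Y m), map_sub]
  abel

theorem L_neg (X : A → A) (φ : A → W) (m : A) : L X (fun m => - φ m) m = - L X φ m := by
  simp [L, fderiv_fun_neg]

end ops

section fields

variable {n : ℕ} {s : Set (M n)}

/-- The vertical field. -/
def VV (n : ℕ) : M n → M n := fun m => (0, m.2.2, 0)

/-- The vector field `D` of the dynamical derivative. -/
def DD {n : ℕ} (Γ : M n → E n) : M n → M n :=
  fun m => (m.2.1, - (2 : ℝ) • Γ m, - L (VV n) Γ m)

/-- The horizontal field. -/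
def HH {n : ℕ} (Γ : M n → E n) : M n → M n :=
  fun m => (m.2.2, - L (VV n) Γ m, - L (VV n) (L (VV n) Γ) m)

/-- The Riemann curvature applied to `v`. -/
def rho {n : ℕ} (Γ : M n → E n) : M n → E n :=
  fun m => (2 : ℝ) • L (HH Γ) Γ m - L (DD Γ) (L (VV n) Γ) m

theorem sm_VV : Sm s (VV n) := by
  unfold Sm VV; fun_prop

theorem sm_DD {Γ : M n → E n} (hs : IsOpen s) (h : Sm s Γ) : Sm s (DD Γ) := by
  have h1 : Sm s (L (VV n) Γ) := h.L sm_VV hs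
  unfold Sm at *
  unfold DD
  exact ContDiffOn.prodMk (by fun_prop) (ContDiffOn.prodMk (by fun_prop) h1.neg)

theorem sm_HH {Γ : M n → E n} (hs : IsOpen s) (h : Sm s Γ) : Sm s (HH Γ) := by
  have h1 : Sm s (L (VV n) Γ) := h.L sm_VV hs
  have h2 : Sm s (L (VV n) (L (VV n) Γ)) := h1.L sm_VV hs
  unfold Sm at *
  unfold HH
  exact ContDiffOn.prodMk (by fun_prop) (ContDiffOn.prodMk h1.neg h2.neg)

theorem L_VV (X : M n → M n) (m : M n) : L X (VV n) m = (0, (X m).2.2, 0) := by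
  have : VV n = (((0 : M n →L[ℝ] E n).prod
    (((ContinuousLinearMap.snd ℝ (E n) (E n)).comp
      (ContinuousLinearMap.snd ℝ (E n) (E n × E n))).prod
        (0 : M n →L[ℝ] E n)) : M n →L[ℝ] M n) : M n → M n) := rfl
  unfold L
  rw [this, ContinuousLinearMap.fderiv]
  rfl

theorem fd_v1 (m w : M n) : fderiv ℝ (fun m : M n => m.2.1) m w = w.2.1 := by
  have : (fun m : M n => m.2.1) = ((ContinuousLinearMap.fst ℝ (E n) (E n)).comp
      (ContinuousLinearMap.snd ℝ (E n) (E n × E n)) : M n →L[ℝ] E n) := rfl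
  rw [this, ContinuousLinearMap.fderiv]
  rfl

theorem fd_v2 (m w : M n) : fderiv ℝ (fun m : M n => m.2.2) m w = w.2.2 := by
  have : (fun m : M n => m.2.2) = ((ContinuousLinearMap.snd ℝ (E n) (E n)).comp
      (ContinuousLinearMap.snd ℝ (E n) (E n × E n)) : M n →L[ℝ] E n) := rfl
  rw [this, ContinuousLinearMap.fderiv]
  rfl

theorem L_DD {Γ : M n → E n} (hs : IsOpen s) (h : Sm s Γ) (X : M n → M n) {m : M n}
    (hm : m ∈ s) : L X (DD Γ) m =
      ((X m).2.1, - (2 : ℝ) • L X Γ m, - L X (L (VV n) Γ) m) := by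
  have h0 := h.diff hs hm
  have h1 : DifferentiableAt ℝ (L (VV n) Γ) m := (h.L sm_VV hs).diff hs hm
  unfold DD
  rw [L, DifferentiableAt.fderiv_prodMk (by fun_prop)
    (DifferentiableAt.prodMk (by fun_prop) (by fun_prop)),
    DifferentiableAt.fderiv_prodMk (by fun_prop) (by fun_prop)]
  simp only [ContinuousLinearMap.prod_apply, fd_v1, fderiv_fun_neg, fderiv_fun_const_smul h0]
  rfl

theorem L_HH {Γ : M n → E n} (hs : IsOpen s) (h : Sm s Γ) (X : M n → M n) {m : M n}
    (hm : m ∈ s) : L X (HH Γ) m =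
      ((X m).2.2, - L X (L (VV n) Γ) m, - L X (L (VV n) (L (VV n) Γ)) m) := by
  have hh1 : Sm s (L (VV n) Γ) := (h.L sm_VV hs)
  have h1 : DifferentiableAt ℝ (L (VV n) Γ) m := hh1.diff hs hm
  have h2 : DifferentiableAt ℝ (L (VV n) (L (VV n) Γ)) m := (hh1.L sm_VV hs).diff hs hm
  unfold HH
  rw [L, DifferentiableAt.fderiv_prodMk (by fun_prop)
    (DifferentiableAt.prodMk (by fun_prop) (by fun_prop)),
    DifferentiableAt.fderiv_prodMk (by fun_prop) (by fun_prop)]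
  simp only [ContinuousLinearMap.prod_apply, fd_v2, fderiv_fun_neg]
  rfl

theorem sm_rho {Γ : M n → E n} (hs : IsOpen s) (h : Sm s Γ) : Sm s (rho Γ) := by
  have h1 : Sm s (L (HH Γ) Γ) := h.L (sm_HH hs h) hs
  have h2 : Sm s (L (DD Γ) (L (VV n) Γ)) := (h.L sm_VV hs).L (sm_DD hs h) hs
  unfold Sm rho at *
  exact (h1.const_smul (2 : ℝ)).sub h2

variable {W : Type*} [NormedAddCommGroup W] [NormedSpace ℝ W]

/-- `[V, D] = H`. -/
theorem comm_VD {Γ : M n → E n} (hs : IsOpen s) (h : Sm s Γ) {φ : M n → W} (hφ : Sm s φ)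
    {m : M n} (hm : m ∈ s) :
    L (VV n) (L (DD Γ) φ) m = L (DD Γ) (L (VV n) φ) m + L (HH Γ) φ m := by
  rw [L_comm hφ sm_VV (sm_DD hs h) hs hm, L_DD hs h _ hm, L_VV]
  congr 1
  have : ((VV n m).2.1, - (2 : ℝ) • L (VV n) Γ m, - L (VV n) (L (VV n) Γ) m) -
      ((0 : E n), (DD Γ m).2.2, (0 : E n)) = HH Γ m := by
    simp only [VV, DD, HH, Prod.mk_sub_mk, Prod.mk.injEq, sub_zero, true_and]
    refine ⟨?_, trivial⟩
    module
  rw [this]; rfl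

/-- `[V, H]` kills functions of `(x, y)`. -/
theorem comm_VH {Γ : M n → E n} (hs : IsOpen s) (h : Sm s Γ) {φ : M n → W} (hφ : Sm s φ)
    {m : M n} (hm : m ∈ s) (hv : ∀ w : E n, fderiv ℝ φ m (0, 0, w) = 0) :
    L (VV n) (L (HH Γ) φ) m = L (HH Γ) (L (VV n) φ) m := by
  rw [L_comm hφ sm_VV (sm_HH hs h) hs hm, L_HH hs h _ hm, L_VV]
  have : ((VV n m).2.2, - L (VV n) (L (VV n) Γ) m, - L (VV n) (L (VV n) (L (VV n) Γ)) m) -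
      ((0 : E n), (HH Γ m).2.2, (0 : E n)) =
      (0, 0, - L (VV n) (L (VV n) (L (VV n) Γ)) m) := by
    simp [VV, HH]
  rw [this, hv, add_zero]

theorem L_rho {Γ : M n → E n} (hs : IsOpen s) (h : Sm s Γ)
    (hv : ∀ m ∈ s, ∀ w : E n, fderiv ℝ Γ m (0, 0, w) = 0) {m : M n} (hm : m ∈ s) :
    L (VV n) (rho Γ) m =
      L (HH Γ) (L (VV n) Γ) m - L (DD Γ) (L (VV n) (L (VV n) Γ)) m := by
  have hN : Sm s (L (VV n) Γ) := h.L sm_VV hs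
  have h1 : Sm s (L (HH Γ) Γ) := h.L (sm_HH hs h) hs
  have h2 : Sm s (L (DD Γ) (L (VV n) Γ)) := hN.L (sm_DD hs h) hs
  have e1 : L (VV n) (rho Γ) m =
      (2 : ℝ) • L (VV n) (L (HH Γ) Γ) m - L (VV n) (L (DD Γ) (L (VV n) Γ)) m := by
    have d1 := h1.diff hs hm
    have d2 := h2.diff hs hm
    unfold rho
    rw [L, fderiv_fun_sub (by fun_prop) d2, fderiv_fun_const_smul d1]
    rfl
  rw [e1, comm_VH hs h h hm (hv m hm), comm_VD hs h hN hm]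
  module

/-- `[D, H] = ρ ∂_y + V(ρ) ∂_v`. -/
theorem comm_DH {Γ : M n → E n} (hs : IsOpen s) (h : Sm s Γ)
    (hv : ∀ m ∈ s, ∀ w : E n, fderiv ℝ Γ m (0, 0, w) = 0)
    {φ : M n → W} (hφ : Sm s φ) {m : M n} (hm : m ∈ s) :
    L (DD Γ) (L (HH Γ) φ) m = L (HH Γ) (L (DD Γ) φ) m +
      fderiv ℝ φ m (0, rho Γ m, L (VV n) (rho Γ) m) := by
  rw [L_comm hφ (sm_DD hs h) (sm_HH hs h) hs hm, L_HH hs h _ hm, L_DD hs h _ hm,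
    L_rho hs h hv hm]
  congr 2
  simp only [DD, HH, rho, Prod.mk_sub_mk, Prod.mk.injEq, sub_self, true_and]
  constructor <;> module

/-- The main identity, abstractly. -/
theorem main_abs {Γ : M n → E n} (hs : IsOpen s) (h : Sm s Γ)
    (hv : ∀ m ∈ s, ∀ w : E n, fderiv ℝ Γ m (0, 0, w) = 0)
    {φ : M n → ℝ} (hφ : Sm s φ) (hφv : ∀ m ∈ s, ∀ w : E n, fderiv ℝ φ m (0, 0, w) = 0)
    (hD : ∀ m ∈ s, L (DD Γ) φ m = 0)
    (hDV : ∀ m ∈ s, L (DD Γ) (L (VV n) φ) m = L (HH Γ) φ m)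
    {m : M n} (hm : m ∈ s) :
    fderiv ℝ φ m (0, rho Γ m, L (VV n) (rho Γ) m) = 0 ∧
    L (DD Γ) (L (DD Γ) (L (VV n) (L (VV n) (L (VV n) φ)))) m =
      - fderiv ℝ (L (VV n) (L (VV n) φ)) m (0, rho Γ m, L (VV n) (rho Γ) m) := by
  have zero : ∀ (X : M n → M n) (ψ : M n → ℝ), (∀ m ∈ s, ψ m = 0) → ∀ m ∈ s, L X ψ m = 0 := by
    intro X ψ hψ m hm
    rw [L_congr hs X (ψ := fun _ => 0) hψ m hm]
    simp [L]
  have s1 : Sm s (L (VV n) φ) := hφ.L sm_VV hs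
  have s2 : Sm s (L (VV n) (L (VV n) φ)) := s1.L sm_VV hs
  have hH : ∀ m ∈ s, L (HH Γ) φ m = 0 := by
    intro m hm
    have := comm_VD hs h hφ hm
    rw [zero _ _ hD m hm, hDV m hm] at this
    linarith
  have hDV0 : ∀ m ∈ s, L (DD Γ) (L (VV n) φ) m = 0 := fun m hm => by rw [hDV m hm, hH m hm]
  have hHV : ∀ m ∈ s, L (HH Γ) (L (VV n) φ) m = 0 := by
    intro m hm
    rw [← comm_VH hs h hφ hm (hφv m hm), zero _ _ hH m hm]
  have hDVV : ∀ m ∈ s, L (DD Γ) (L (VV n) (L (VV n) φ)) m = 0 := by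
    intro m hm
    have := comm_VD hs h s1 hm
    rw [zero _ _ hDV0 m hm, hHV m hm] at this
    linarith
  have hDVVV : ∀ m ∈ s, L (DD Γ) (L (VV n) (L (VV n) (L (VV n) φ))) m =
      - L (HH Γ) (L (VV n) (L (VV n) φ)) m := by
    intro m hm
    have := comm_VD hs h s2 hm
    rw [zero _ _ hDVV m hm] at this
    linarith
  constructor
  · have := comm_DH hs h hv hφ hm
    rw [zero _ _ hH m hm, zero _ _ hD m hm] at this
    linarith
  · rw [L_congr hs _ hDVVV m hm, L_neg, comm_DH hs h hv s2 hm, zero _ _ hDVV m hm, zero_add]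

end fields

section base

variable {n : ℕ} {U : Set (E n)}

/-- The slit tangent bundle over `U`. -/
def Om (U : Set (E n)) : Set (E n × E n) := U ×ˢ {y : E n | y ≠ 0}

/-- Its pullback. -/
def OmM (U : Set (E n)) : Set (M n) := {m | m.1 ∈ U ∧ m.2.1 ≠ 0}

/-- Smoothness of a function of `(x, y)`. -/
def SF (U : Set (E n)) (f : E n → E n → ℝ) : Prop :=
  Sm (Om U) (fun p : E n × E n => f p.1 p.2)

/-- The lift of a function of `(x, y)`. -/
def lift (f : E n → E n → ℝ) : M n → ℝ := fun m => f m.1 m.2.1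

theorem Om_open (hU : IsOpen U) : IsOpen (Om U) := hU.prod isOpen_ne

theorem OmM_open (hU : IsOpen U) : IsOpen (OmM U) := by
  have : OmM U = (fun m : M n => (m.1, m.2.1)) ⁻¹' Om U := by
    ext m; simp [OmM, Om]
  rw [this]
  exact (Om_open hU).preimage (by fun_prop)

theorem SF.fdy {f : E n → E n → ℝ} (h : SF U f) (hU : IsOpen U) {x y : E n} (hx : x ∈ U)
    (hy : y ≠ 0) : HasFDerivAt (f x) ((fderiv ℝ (fun p : E n × E n => f p.1 p.2) (x, y)).comp
      (ContinuousLinearMap.inr ℝ (E n) (E n))) y := by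
  have h1 := (h.diff (Om_open hU) (m := (x, y)) ⟨hx, hy⟩).hasFDerivAt
  exact h1.comp y (hasFDerivAt_prodMk_right x y)

theorem SF.fdx {f : E n → E n → ℝ} (h : SF U f) (hU : IsOpen U) {x y : E n} (hx : x ∈ U)
    (hy : y ≠ 0) : HasFDerivAt (fun x' => f x' y)
      ((fderiv ℝ (fun p : E n × E n => f p.1 p.2) (x, y)).comp
      (ContinuousLinearMap.inl ℝ (E n) (E n))) x := by
  have h1 := (h.diff (Om_open hU) (m := (x, y)) ⟨hx, hy⟩).hasFDerivAt
  exact HasFDerivAt.comp (g := fun p : E n × E n => f p.1 p.2) (f := fun x' => (x', y)) x h1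
    (hasFDerivAt_prodMk_left x y)

theorem pdy_eq {f : E n → E n → ℝ} (h : SF U f) (hU : IsOpen U) (i : Fin n) :
    ∀ p ∈ Om U, pdy n f i p.1 p.2 =
      L (fun _ => ((0 : E n), e n i)) (fun p : E n × E n => f p.1 p.2) p := by
  rintro ⟨x, y⟩ ⟨hx, hy⟩
  simp only [pdy]
  rw [(h.fdy hU hx hy).fderiv]
  simp [L]

theorem pdx_eq {f : E n → E n → ℝ} (h : SF U f) (hU : IsOpen U) (i : Fin n) :
    ∀ p ∈ Om U, pdx n f i p.1 p.2 =
      L (fun _ => (e n i, (0 : E n))) (fun p : E n × E n => f p.1 p.2) p := by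
  rintro ⟨x, y⟩ ⟨hx, hy⟩
  simp only [pdx]
  rw [(h.fdx hU hx hy).fderiv]
  simp [L]

theorem SF.pdy {f : E n → E n → ℝ} (h : SF U f) (hU : IsOpen U) (i : Fin n) :
    SF U (pdy n f i) :=
  ContDiffOn.congr (Sm.L h (X := fun _ => ((0 : E n), e n i)) contDiffOn_const (Om_open hU))
    (pdy_eq h hU i)

theorem SF.pdx {f : E n → E n → ℝ} (h : SF U f) (hU : IsOpen U) (i : Fin n) :
    SF U (pdx n f i) :=
  ContDiffOn.congr (Sm.L h (X := fun _ => (e n i, (0 : E n))) contDiffOn_const (Om_open hU))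
    (pdx_eq h hU i)

theorem pdy_comm {f : E n → E n → ℝ} (h : SF U f) (hU : IsOpen U) (i j : Fin n)
    {x y : E n} (hx : x ∈ U) (hy : y ≠ 0) :
    pdy n (pdy n f i) j x y = pdy n (pdy n f j) i x y := by
  have hm : (x, y) ∈ Om U := ⟨hx, hy⟩
  have a1 := pdy_eq (h.pdy hU i) hU j (x, y) hm
  have a2 := pdy_eq (h.pdy hU j) hU i (x, y) hm
  rw [L_congr (Om_open hU) _ (pdy_eq h hU i) _ hm] at a1
  rw [L_congr (Om_open hU) _ (pdy_eq h hU j) _ hm] at a2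
  simp only at a1 a2
  rw [a1, a2, L_comm h contDiffOn_const contDiffOn_const (Om_open hU) hm]
  simp [L]

theorem pdy_congr {f g : E n → E n → ℝ}
    (h : ∀ x ∈ U, ∀ y, y ≠ 0 → f x y = g x y) (i : Fin n) {x y : E n} (hx : x ∈ U)
    (hy : y ≠ 0) : pdy n f i x y = pdy n g i x y := by
  have : f x =ᶠ[nhds y] g x :=
    Filter.eventually_of_mem (isOpen_ne.mem_nhds hy) (fun z hz => h x hx z hz)
  simp only [pdy, this.fderiv_eq]

theorem pdx_congr (hU : IsOpen U) {f g : E n → E n → ℝ}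
    (h : ∀ x ∈ U, ∀ y, y ≠ 0 → f x y = g x y) (i : Fin n) {x y : E n} (hx : x ∈ U)
    (hy : y ≠ 0) : pdx n f i x y = pdx n g i x y := by
  have : (fun x' => f x' y) =ᶠ[nhds x] (fun x' => g x' y) :=
    Filter.eventually_of_mem (hU.mem_nhds hx) (fun z hz => h z hz y hy)
  simp only [pdx, this.fderiv_eq]

theorem vec_sum (v : E n) : v = ∑ k, v k • e n k := by
  ext j
  simp [e, Finset.sum_apply, Pi.single_apply]

theorem fd_y {f : E n → E n → ℝ} (x y v : E n) :
    fderiv ℝ (f x) y v = ∑ k, v k * pdy n f k x y := by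
  conv_lhs => rw [vec_sum v, map_sum]
  simp [pdy]

theorem fd_p {f : E n → E n → ℝ} (h : SF U f) (hU : IsOpen U) {x y : E n} (hx : x ∈ U)
    (hy : y ≠ 0) (a b : E n) :
    fderiv ℝ (fun p : E n × E n => f p.1 p.2) (x, y) (a, b) =
      ∑ k, a k * pdx n f k x y + ∑ k, b k * pdy n f k x y := by
  have : (a, b) = ∑ k, a k • (e n k, (0 : E n)) + ∑ k, b k • ((0 : E n), e n k) := by
    apply Prod.ext
    · simp [Prod.fst_sum, ← vec_sum]
    · simp [Prod.snd_sum, ← vec_sum]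
  rw [this, map_add, map_sum, map_sum]
  congr 1
  · refine Finset.sum_congr rfl fun k _ => ?_
    rw [map_smul, smul_eq_mul]
    congr 1
    exact (pdx_eq h hU k (x, y) ⟨hx, hy⟩).symm
  · refine Finset.sum_congr rfl fun k _ => ?_
    rw [map_smul, smul_eq_mul]
    congr 1
    exact (pdy_eq h hU k (x, y) ⟨hx, hy⟩).symm

theorem sm_lift {f : E n → E n → ℝ} (h : SF U f) : Sm (OmM U) (lift f) :=
  ContDiffOn.comp (g := fun p : E n × E n => f p.1 p.2) (f := fun m : M n => (m.1, m.2.1))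
    h (by fun_prop) (fun _ hm => ⟨hm.1, hm.2⟩)

theorem fd_lift {f : E n → E n → ℝ} (h : SF U f) (hU : IsOpen U) {m : M n} (hm : m ∈ OmM U)
    (w : M n) : fderiv ℝ (lift f) m w =
      ∑ k, w.1 k * pdx n f k m.1 m.2.1 + ∑ k, w.2.1 k * pdy n f k m.1 m.2.1 := by
  have h1 := (h.diff (Om_open hU) (m := (m.1, m.2.1)) ⟨hm.1, hm.2⟩).hasFDerivAt
  have h2 : HasFDerivAt (fun m : M n => (m.1, m.2.1))
    ((ContinuousLinearMap.fst ℝ (E n) (E n × E n)).prod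
      ((ContinuousLinearMap.fst ℝ (E n) (E n)).comp
        (ContinuousLinearMap.snd ℝ (E n) (E n × E n)))) m :=
    (((ContinuousLinearMap.fst ℝ (E n) (E n × E n)).prod
      ((ContinuousLinearMap.fst ℝ (E n) (E n)).comp
        (ContinuousLinearMap.snd ℝ (E n) (E n × E n))))).hasFDerivAt
  have h3 := HasFDerivAt.comp (g := fun p : E n × E n => f p.1 p.2) m h1 h2
  have : fderiv ℝ (lift f) m = _ := h3.fderiv
  rw [this, ← fd_p h hU hm.1 hm.2]
  rfl

/-- Positive homogeneity of degree `k`. -/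
def Hom (U : Set (E n)) (k : ℕ) (f : E n → E n → ℝ) : Prop :=
  ∀ x ∈ U, ∀ y : E n, y ≠ 0 → ∀ c : ℝ, 0 < c → f x (c • y) = c ^ k * f x y

theorem Hom.pdx {k : ℕ} {f : E n → E n → ℝ} (h : Hom U k f) (hU : IsOpen U) (hf : SF U f)
    (i : Fin n) : Hom U k (pdx n f i) := by
  intro x hx y hy c hc
  have : (fun x' => f x' (c • y)) =ᶠ[nhds x] (fun x' => c ^ k * f x' y) :=
    Filter.eventually_of_mem (hU.mem_nhds hx) (fun z hz => h z hz y hy c hc)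
  simp only [Paper.pdx, this.fderiv_eq]
  rw [fderiv_const_mul (hf.fdx hU hx hy).differentiableAt]
  simp

theorem Hom.pdy {k : ℕ} {f : E n → E n → ℝ} (h : Hom U (k + 1) f) (hU : IsOpen U)
    (hf : SF U f) (i : Fin n) : Hom U k (pdy n f i) := by
  intro x hx y hy c hc
  have : (fun y' => f x (c • y')) =ᶠ[nhds y] (fun y' => c ^ (k + 1) * f x y') :=
    Filter.eventually_of_mem (isOpen_ne.mem_nhds hy) (fun z hz => h x hx z hz c hc)
  have hcy : c • y ≠ 0 := smul_ne_zero hc.ne' hy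
  have h1 : fderiv ℝ (fun y' => f x (c • y')) y (e n i) = c * fderiv ℝ (f x) (c • y) (e n i) := by
    have h2 : HasFDerivAt (fun y' : E n => c • y') (c • ContinuousLinearMap.id ℝ (E n)) y :=
      (hasFDerivAt_id y).const_smul c
    have h3 := HasFDerivAt.comp y (hf.fdy hU hx hcy) h2
    have h4 : fderiv ℝ (fun y' => f x (c • y')) y = _ := h3.fderiv
    rw [h4, (hf.fdy hU hx hcy).fderiv]
    simp
  rw [this.fderiv_eq, fderiv_const_mul (hf.fdy hU hx hy).differentiableAt] at h1
  simp only [Paper.pdy]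
  simp only [smul_apply, smul_eq_mul] at h1
  have : c * (c ^ k * fderiv ℝ (f x) y (e n i)) = c * fderiv ℝ (f x) (c • y) (e n i) := by
    rw [← h1]; ring
  exact (mul_left_cancel₀ hc.ne' this).symm

theorem Hom.euler {k : ℕ} {f : E n → E n → ℝ} (h : Hom U k f) (hU : IsOpen U)
    (hf : SF U f) {x y : E n} (hx : x ∈ U) (hy : y ≠ 0) :
    ∑ i, y i * Paper.pdy n f i x y = k * f x y := by
  rw [← fd_y]
  have h1 : HasDerivAt (fun c : ℝ => f x (c • y)) (fderiv ℝ (f x) y y) 1 := by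
    have h2 : HasDerivAt (fun c : ℝ => c • y) y 1 := by
      simpa using (hasDerivAt_id (1 : ℝ)).smul_const y
    have h3 : HasFDerivAt (f x) (fderiv ℝ (f x) y) ((1 : ℝ) • y) := by
      rw [one_smul]; exact (hf.fdy hU hx hy).differentiableAt.hasFDerivAt
    exact h3.comp_hasDerivAt 1 h2
  have h4 : HasDerivAt (fun c : ℝ => c ^ k * f x y) (k * f x y) 1 := by
    simpa using (hasDerivAt_pow k (1 : ℝ)).mul_const (f x y)
  have h5 : (fun c : ℝ => f x (c • y)) =ᶠ[nhds 1] (fun c : ℝ => c ^ k * f x y) :=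
    Filter.eventually_of_mem (lt_mem_nhds one_pos) (fun c hc => h x hx y hy c hc)
  exact (h1.congr_of_eventuallyEq h5.symm).unique h4

end base

section finsler

variable {n : ℕ} {U : Set (E n)} {F : E n → E n → ℝ}

theorem sf_F (hF : IsFinsler n U F) : SF U F := hF.smooth

theorem sf_F2 (hF : IsFinsler n U F) : SF U (F2 n F) :=
  ContDiffOn.pow (sf_F hF) 2

theorem sf_gm (hU : IsOpen U) (hF : IsFinsler n U F) (i j : Fin n) : SF U (gm n F i j) :=
  contDiffOn_const.mul (((sf_F2 hF).pdy hU j).pdy hU i)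

theorem sf_det (g : Fin n → Fin n → E n → E n → ℝ) (hg : ∀ i j, SF U (g i j)) :
    SF U (fun x y => (Matrix.of fun i j => g i j x y).det) := by
  simp only [SF, Matrix.det_apply, Sm]
  apply ContDiffOn.sum
  intro σ _
  apply ContDiffOn.const_smul
  apply contDiffOn_prod
  intro i _
  exact hg _ _

theorem sf_ginv (hU : IsOpen U) (hF : IsFinsler n U F) (i j : Fin n) :
    SF U (fun x y => ginv n F x y i j) := by
  have h1 : SF U (fun x y => (gmat n F x y).det) := sf_det _ (sf_gm hU hF)
  have h2 : SF U (fun x y => (gmat n F x y).adjugate i j) := by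
    simp only [Matrix.adjugate_apply]
    have := sf_det (U := U) (fun a b x y => if a = j then (Pi.single i (1 : ℝ) : Fin n → ℝ) b
      else gm n F a b x y) (by
        intro a b
        by_cases h : a = j
        · simp only [h, if_true]; exact contDiffOn_const
        · simp only [h, if_false]; exact sf_gm hU hF a b)
    convert this using 4 with x y
    ext a b
    simp [Matrix.updateRow_apply, gmat]
  have h3 : ∀ p ∈ Om U, ginv n F p.1 p.2 i j =
      ((gmat n F p.1 p.2).det)⁻¹ * (gmat n F p.1 p.2).adjugate i j := by
    intro p hp
    simp [ginv, Matrix.inv_def, Ring.inverse_eq_inv']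
  refine ContDiffOn.congr (ContDiffOn.mul (ContDiffOn.inv h1 ?_) h2) h3
  intro p hp
  exact (hF.posdef p.1 hp.1 p.2 hp.2).det_pos.ne'

theorem sf_coord (i : Fin n) : SF U (fun _ y => y i) := by
  simp only [SF, Sm]; fun_prop

theorem sf_Spray (hU : IsOpen U) (hF : IsFinsler n U F) (i : Fin n) : SF U (Spray n F i) := by
  have hp := sf_F2 hF
  refine contDiffOn_const.mul (ContDiffOn.sum fun l _ => ?_)
  refine (sf_ginv hU hF i l).mul (ContDiffOn.sub (ContDiffOn.sum fun k _ => ?_) (hp.pdx hU l))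
  exact ((hp.pdy hU l).pdx hU k).mul (sf_coord k)

theorem sf_Cartan (hU : IsOpen U) (hF : IsFinsler n U F) (i j k : Fin n) :
    SF U (Cartan n F i j k) :=
  contDiffOn_const.mul ((((sf_F2 hF).pdy hU k).pdy hU j).pdy hU i)

theorem gm_symm (hF : IsFinsler n U F) {x y : E n} (hx : x ∈ U) (hy : y ≠ 0) (i j : Fin n) :
    gm n F i j x y = gm n F j i x y := by
  have := (hF.posdef x hx y hy).isHermitian.apply i j
  simpa [gmat] using this.symm

theorem hom_F2 (hF : IsFinsler n U F) : Hom U 2 (F2 n F) := by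
  intro x hx y hy c hc
  simp only [F2, hF.homog x hx y hy c hc]; ring

theorem hom_Spray (hU : IsOpen U) (hF : IsFinsler n U F) (i : Fin n) :
    Hom U 2 (Spray n F i) := by
  intro x hx y hy c hc
  have hp := sf_F2 hF
  have hh := hom_F2 hF
  have h1 : gmat n F x (c • y) = gmat n F x y := by
    ext a b
    have := (Hom.pdy (k := 0) (Hom.pdy (k := 1) hh hU hp b) hU (hp.pdy hU b) a) x hx y hy c hc
    simp only [gmat, gm, Matrix.of_apply, this]
    ring
  simp only [Spray, ginv, h1]
  rw [mul_left_comm, Finset.mul_sum _ _ (c ^ 2)]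
  congr 1
  refine Finset.sum_congr rfl fun l _ => ?_
  rw [hh.pdx hU hp l x hx y hy c hc, mul_left_comm, mul_sub (c ^ 2), Finset.mul_sum _ _ (c ^ 2)]
  congr 2
  refine Finset.sum_congr rfl fun k _ => ?_
  rw [(Hom.pdy (k := 1) hh hU hp l).pdx hU (hp.pdy hU l) k x hx y hy c hc]
  simp; ring

/-- The defining equation of the spray. -/
theorem spray_eq (hF : IsFinsler n U F) {x y : E n} (hx : x ∈ U) (hy : y ≠ 0) (l : Fin n) :
    4 * ∑ i, gm n F l i x y * Spray n F i x y =
      (∑ k, pdx n (pdy n (F2 n F) l) k x y * y k) - pdx n (F2 n F) l x y := by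
  set S : E n := fun l => (∑ k, pdx n (pdy n (F2 n F) l) k x y * y k) - pdx n (F2 n F) l x y
    with hS
  have h1 : (fun i => Spray n F i x y) = (1 / 4 : ℝ) • ((gmat n F x y)⁻¹).mulVec S := by
    ext i
    simp [Spray, Matrix.mulVec, dotProduct, ginv, hS]
  have h2 : (gmat n F x y).mulVec (fun i => Spray n F i x y) = (1 / 4 : ℝ) • S := by
    rw [h1, Matrix.mulVec_smul, Matrix.mulVec_mulVec, Matrix.mul_nonsing_inv, Matrix.one_mulVec]
    exact (hF.posdef x hx y hy).det_pos.ne'.isUnit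
  have h3 := congrFun h2 l
  simp only [Matrix.mulVec, dotProduct, gmat, Matrix.of_apply, Pi.smul_apply, smul_eq_mul] at h3
  rw [h3]; simp only [hS]; ring

theorem euler_F2y (hU : IsOpen U) (hF : IsFinsler n U F) {x y : E n} (hx : x ∈ U)
    (hy : y ≠ 0) (j : Fin n) : pdy n (F2 n F) j x y = 2 * ∑ i, gm n F i j x y * y i := by
  have := (Hom.pdy (k := 1) (hom_F2 hF) hU (sf_F2 hF) j).euler hU ((sf_F2 hF).pdy hU j) hx hy
  simp only [Nat.cast_one, one_mul] at this
  rw [← this, Finset.mul_sum]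
  refine Finset.sum_congr rfl fun i _ => ?_
  simp only [gm]; ring

theorem euler_F2xy (hU : IsOpen U) (hF : IsFinsler n U F) {x y : E n} (hx : x ∈ U)
    (hy : y ≠ 0) (k : Fin n) :
    ∑ l, y l * pdx n (pdy n (F2 n F) l) k x y = 2 * pdx n (F2 n F) k x y := by
  have hp := sf_F2 hF
  have h1 : ∀ x ∈ U, ∀ y, y ≠ 0 → ∑ i, y i * pdy n (F2 n F) i x y = 2 * F2 n F x y := by
    intro x hx y hy
    exact_mod_cast (hom_F2 hF).euler hU hp hx hy
  have h2 := pdx_congr (f := fun x y => ∑ i, y i * pdy n (F2 n F) i x y)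
    (g := fun x y => 2 * F2 n F x y) hU h1 k hx hy
  simp only [pdx] at h2
  rw [fderiv_const_mul (hp.fdx hU hx hy).differentiableAt, fderiv_fun_sum] at h2
  · simp only [sum_apply, smul_apply, smul_eq_mul] at h2
    simp only [pdx]
    rw [← h2]
    refine Finset.sum_congr rfl fun l _ => ?_
    rw [fderiv_const_mul ((hp.pdy hU l).fdx hU hx hy).differentiableAt]
    simp
  · intro l _
    exact ((hp.pdy hU l).fdx hU hx hy).differentiableAt.const_mul _

end finsler

section calc_rules

variable {n : ℕ} {U : Set (E n)} {F : E n → E n → ℝ}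

theorem L_mul {φ ψ : M n → ℝ} (X : M n → M n) {m : M n} (h1 : DifferentiableAt ℝ φ m)
    (h2 : DifferentiableAt ℝ ψ m) :
    L X (fun m => φ m * ψ m) m = L X φ m * ψ m + φ m * L X ψ m := by
  simp only [L]
  rw [fderiv_fun_mul h1 h2]
  simp; ring

theorem L_sum {ι : Type*} [Fintype ι] {φ : ι → M n → ℝ} (X : M n → M n) {m : M n}
    (h1 : ∀ i, DifferentiableAt ℝ (φ i) m) :
    L X (fun m => ∑ i, φ i m) m = ∑ i, L X (φ i) m := by
  simp only [L]
  rw [fderiv_fun_sum (fun i _ => h1 i)]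
  simp

theorem L_vco (X : M n → M n) (m : M n) (i : Fin n) :
    L X (fun m : M n => m.2.2 i) m = (X m).2.2 i := by
  have : (fun m : M n => m.2.2 i) = ((ContinuousLinearMap.proj (R := ℝ) (φ := fun _ => ℝ) i).comp
      ((ContinuousLinearMap.snd ℝ (E n) (E n)).comp
      (ContinuousLinearMap.snd ℝ (E n) (E n × E n))) : M n →L[ℝ] ℝ) := rfl
  rw [L, this, ContinuousLinearMap.fderiv]
  rfl

theorem L_pi {Φ : M n → E n} (X : M n → M n) {m : M n} (h : DifferentiableAt ℝ Φ m)
    (i : Fin n) : L X Φ m i = L X (fun m => Φ m i) m := by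
  simp only [L]
  rw [fderiv_apply h]
  rfl

theorem L_lift {f : E n → E n → ℝ} (h : SF U f) (hU : IsOpen U) (X : M n → M n) {m : M n}
    (hm : m ∈ OmM U) : L X (lift f) m =
      ∑ k, (X m).1 k * pdx n f k m.1 m.2.1 + ∑ k, (X m).2.1 k * pdy n f k m.1 m.2.1 :=
  fd_lift h hU hm _

theorem LV_lift {f : E n → E n → ℝ} (h : SF U f) (hU : IsOpen U) {m : M n}
    (hm : m ∈ OmM U) : L (VV n) (lift f) m = ∑ k, lift (pdy n f k) m * m.2.2 k := by
  rw [L_lift h hU _ hm]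
  simp [VV, lift, mul_comm]

/-- linear forms in `v` -/
def lin1 (f : Fin n → E n → E n → ℝ) : M n → ℝ := fun m => ∑ i, lift (f i) m * m.2.2 i

/-- quadratic forms in `v` -/
def lin2 (f : Fin n → Fin n → E n → E n → ℝ) : M n → ℝ :=
  fun m => ∑ i, ∑ j, lift (f i j) m * m.2.2 i * m.2.2 j

/-- cubic forms in `v` -/
def lin3 (f : Fin n → Fin n → Fin n → E n → E n → ℝ) : M n → ℝ :=
  fun m => ∑ i, ∑ j, ∑ k, lift (f i j k) m * m.2.2 i * m.2.2 j * m.2.2 k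

theorem L_lin1 {f : Fin n → E n → E n → ℝ} (hU : IsOpen U) (h : ∀ i, SF U (f i))
    (X : M n → M n) {m : M n} (hm : m ∈ OmM U) :
    L X (lin1 f) m = ∑ i, (L X (lift (f i)) m * m.2.2 i + lift (f i) m * (X m).2.2 i) := by
  have hd : ∀ i, DifferentiableAt ℝ (lift (f i)) m :=
    fun i => (sm_lift (h i)).diff (OmM_open hU) hm
  unfold lin1
  rw [L_sum _ (fun i => by have := hd i; fun_prop)]
  refine Finset.sum_congr rfl fun i _ => ?_
  rw [L_mul _ (hd i) (by fun_prop), L_vco]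

theorem L_lin2 {f : Fin n → Fin n → E n → E n → ℝ} (hU : IsOpen U) (h : ∀ i j, SF U (f i j))
    (X : M n → M n) {m : M n} (hm : m ∈ OmM U) :
    L X (lin2 f) m = ∑ i, ∑ j, (L X (lift (f i j)) m * m.2.2 i * m.2.2 j
      + lift (f i j) m * (X m).2.2 i * m.2.2 j + lift (f i j) m * m.2.2 i * (X m).2.2 j) := by
  have hd : ∀ i j, DifferentiableAt ℝ (lift (f i j)) m :=
    fun i j => (sm_lift (h i j)).diff (OmM_open hU) hm
  unfold lin2
  rw [L_sum _ (fun i => by have := hd i; fun_prop)]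
  refine Finset.sum_congr rfl fun i _ => ?_
  rw [L_sum _ (fun j => by have := hd i j; fun_prop)]
  refine Finset.sum_congr rfl fun j _ => ?_
  have := hd i j
  rw [L_mul _ (by fun_prop) (by fun_prop), L_mul _ (by fun_prop) (by fun_prop), L_vco, L_vco]
  ring

theorem L_lin3 {f : Fin n → Fin n → Fin n → E n → E n → ℝ} (hU : IsOpen U)
    (h : ∀ i j k, SF U (f i j k)) (X : M n → M n) {m : M n} (hm : m ∈ OmM U) :
    L X (lin3 f) m = ∑ i, ∑ j, ∑ k, (L X (lift (f i j k)) m * m.2.2 i * m.2.2 j * m.2.2 k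
      + lift (f i j k) m * (X m).2.2 i * m.2.2 j * m.2.2 k
      + lift (f i j k) m * m.2.2 i * (X m).2.2 j * m.2.2 k
      + lift (f i j k) m * m.2.2 i * m.2.2 j * (X m).2.2 k) := by
  have hd : ∀ i j k, DifferentiableAt ℝ (lift (f i j k)) m :=
    fun i j k => (sm_lift (h i j k)).diff (OmM_open hU) hm
  unfold lin3
  rw [L_sum _ (fun i => by have := hd i; fun_prop)]
  refine Finset.sum_congr rfl fun i _ => ?_
  rw [L_sum _ (fun j => by have := hd i j; fun_prop)]
  refine Finset.sum_congr rfl fun j _ => ?_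
  rw [L_sum _ (fun k => by have := hd i j k; fun_prop)]
  refine Finset.sum_congr rfl fun k _ => ?_
  have := hd i j k
  rw [L_mul _ (by fun_prop) (by fun_prop), L_mul _ (by fun_prop) (by fun_prop),
    L_mul _ (by fun_prop) (by fun_prop), L_vco, L_vco, L_vco]
  ring

theorem LV_lin1 {f : Fin n → E n → E n → ℝ} (hU : IsOpen U) (h : ∀ i, SF U (f i)) :
    ∀ m ∈ OmM U, L (VV n) (lin1 f) m = lin2 (fun i j => pdy n (f j) i) m := by
  intro m hm
  rw [L_lin1 hU h _ hm]
  simp only [LV_lift (h _) hU hm, lin2]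
  rw [Finset.sum_comm]
  refine Finset.sum_congr rfl fun i _ => ?_
  simp [VV, Finset.sum_mul]

theorem LV_lin2 {f : Fin n → Fin n → E n → E n → ℝ} (hU : IsOpen U) (h : ∀ i j, SF U (f i j)) :
    ∀ m ∈ OmM U, L (VV n) (lin2 f) m = lin3 (fun i j k => pdy n (f j k) i) m := by
  intro m hm
  rw [L_lin2 hU h _ hm]
  simp only [LV_lift (h _ _) hU hm, lin3]
  conv_rhs => rw [Finset.sum_comm]
  refine Finset.sum_congr rfl fun i _ => ?_
  conv_rhs => rw [Finset.sum_comm]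
  refine Finset.sum_congr rfl fun i _ => ?_
  simp [VV, Finset.sum_mul]

theorem sum4 (f : Fin n → Fin n → Fin n → Fin n → ℝ) :
    ∑ i, ∑ j, ∑ k, ∑ m, f i j k m = ∑ m, ∑ j, ∑ k, ∑ i, f i j k m := by
  calc ∑ i, ∑ j, ∑ k, ∑ m, f i j k m = ∑ j, ∑ i, ∑ k, ∑ m, f i j k m := Finset.sum_comm
    _ = ∑ j, ∑ k, ∑ i, ∑ m, f i j k m := by
        refine Finset.sum_congr rfl fun j _ => Finset.sum_comm
    _ = ∑ j, ∑ k, ∑ m, ∑ i, f i j k m := by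
        refine Finset.sum_congr rfl fun j _ => Finset.sum_congr rfl fun k _ => Finset.sum_comm
    _ = ∑ j, ∑ m, ∑ k, ∑ i, f i j k m := by
        refine Finset.sum_congr rfl fun j _ => Finset.sum_comm
    _ = _ := Finset.sum_comm

/-- The lifted spray coefficients. -/
def Gam (n : ℕ) (F : E n → E n → ℝ) : M n → E n := fun m i => lift (Spray n F i) m

theorem sm_Gam (hU : IsOpen U) (hF : IsFinsler n U F) : Sm (OmM U) (Gam n F) :=
  contDiffOn_pi.2 fun i => sm_lift (sf_Spray hU hF i)

theorem Gam_v (hU : IsOpen U) (hF : IsFinsler n U F) :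
    ∀ m ∈ OmM U, ∀ w : E n, fderiv ℝ (Gam n F) m (0, 0, w) = 0 := by
  intro m hm w
  ext i
  have h1 := L_pi (fun _ => ((0 : E n), (0 : E n), w)) ((sm_Gam hU hF).diff (OmM_open hU) hm) i
  have h2 := L_lift (sf_Spray hU hF i) hU (fun _ => ((0 : E n), (0 : E n), w)) hm
  simp only [L] at h1
  rw [h1]
  simpa [L, Gam] using h2

theorem N_eq (hU : IsOpen U) (hF : IsFinsler n U F) {m : M n} (hm : m ∈ OmM U) (i : Fin n) :
    L (VV n) (Gam n F) m i = lin1 (fun k => pdy n (Spray n F i) k) m := by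
  rw [L_pi _ ((sm_Gam hU hF).diff (OmM_open hU) hm)]
  exact LV_lift (sf_Spray hU hF i) hU hm

theorem LD_lift {f : E n → E n → ℝ} (h : SF U f) (hU : IsOpen U) {m : M n}
    (hm : m ∈ OmM U) : L (DD (Gam n F)) (lift f) m = lift (Gop n F f) m := by
  rw [L_lift h hU _ hm]
  simp [DD, Gop, lift, Gam, Finset.mul_sum, mul_assoc, sub_eq_add_neg]

theorem rho_eq (hU : IsOpen U) (hF : IsFinsler n U F) {m : M n} (hm : m ∈ OmM U) (i : Fin n) :
    rho (Gam n F) m i = lin1 (fun k => RiemUp n F i k) m := by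
  have hG := sm_Gam hU hF
  have hs := OmM_open hU
  have hN : Sm (OmM U) (L (VV n) (Gam n F)) := hG.L sm_VV hs
  have hsp := sf_Spray hU hF
  have e1 : L (HH (Gam n F)) (Gam n F) m i = ∑ k, m.2.2 k * pdx n (Spray n F i) k m.1 m.2.1
      - ∑ j, lin1 (fun k => pdy n (Spray n F j) k) m * pdy n (Spray n F i) j m.1 m.2.1 := by
    rw [L_pi _ (hG.diff hs hm)]
    refine (L_lift (hsp i) hU _ hm).trans ?_
    simp [HH, N_eq hU hF hm, sub_eq_add_neg]
  have e2 : L (DD (Gam n F)) (L (VV n) (Gam n F)) m i =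
      ∑ k, (lift (Gop n F (pdy n (Spray n F i) k)) m * m.2.2 k
       - pdy n (Spray n F i) k m.1 m.2.1 * lin1 (fun l => pdy n (Spray n F k) l) m) := by
    rw [L_pi _ (hN.diff hs hm), L_congr hs _ (fun m hm => N_eq hU hF hm i) m hm,
      L_lin1 hU (fun k => (hsp i).pdy hU k) _ hm]
    refine Finset.sum_congr rfl fun k _ => ?_
    rw [LD_lift ((hsp i).pdy hU k) hU hm]
    simp [DD, N_eq hU hF hm, lift, sub_eq_add_neg]
  have e3 : ∑ k, m.2.2 k * (∑ j, pdy n (Spray n F i) j m.1 m.2.1 *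
      pdy n (Spray n F j) k m.1 m.2.1) = 
      ∑ j, lin1 (fun k => pdy n (Spray n F j) k) m * pdy n (Spray n F i) j m.1 m.2.1 := by
    simp only [lin1, lift, Finset.mul_sum, Finset.sum_mul]
    rw [Finset.sum_comm]
    refine Finset.sum_congr rfl fun j _ => Finset.sum_congr rfl fun k _ => ?_
    ring
  have e4 : lin1 (fun k => RiemUp n F i k) m =
      2 * ∑ k, m.2.2 k * pdx n (Spray n F i) k m.1 m.2.1
      - ∑ k, lift (Gop n F (pdy n (Spray n F i) k)) m * m.2.2 k
      - ∑ j, lin1 (fun k => pdy n (Spray n F j) k) m * pdy n (Spray n F i) j m.1 m.2.1 := by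
    rw [← e3, Finset.mul_sum, ← Finset.sum_sub_distrib, ← Finset.sum_sub_distrib]
    refine Finset.sum_congr rfl fun k _ => ?_
    simp only [lift, RiemUp, Gop]
    ring
  have e5 : rho (Gam n F) m i = 2 * L (HH (Gam n F)) (Gam n F) m i
    - L (DD (Gam n F)) (L (VV n) (Gam n F)) m i := rfl
  rw [e5, e1, e2, e4, Finset.sum_sub_distrib]
  have : ∑ k, pdy n (Spray n F i) k m.1 m.2.1 * lin1 (fun l => pdy n (Spray n F k) l) m =
    ∑ j, lin1 (fun k => pdy n (Spray n F j) k) m * pdy n (Spray n F i) j m.1 m.2.1 :=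
    Finset.sum_congr rfl fun k _ => mul_comm _ _
  rw [this]; ring

theorem sf_Gop (hU : IsOpen U) (hF : IsFinsler n U F) {f : E n → E n → ℝ} (h : SF U f) :
    SF U (Gop n F f) := by
  refine ContDiffOn.sub (ContDiffOn.sum fun k _ => ?_)
    (contDiffOn_const.mul (ContDiffOn.sum fun k _ => ?_))
  · exact (sf_coord k).mul (h.pdx hU k)
  · exact (sf_Spray hU hF k).mul (h.pdy hU k)

theorem sf_Dyn3 (hU : IsOpen U) (hF : IsFinsler n U F)
    {T : Fin n → Fin n → Fin n → E n → E n → ℝ} (h : ∀ i j k, SF U (T i j k)) (i j k : Fin n) :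
    SF U (Dyn3 n F T i j k) := by
  have hsp := sf_Spray hU hF
  refine ContDiffOn.sub (ContDiffOn.sub (ContDiffOn.sub (sf_Gop hU hF (h i j k)) ?_) ?_) ?_ <;>
  refine ContDiffOn.sum fun m _ => ContDiffOn.mul ((hsp m).pdy hU _) (h _ _ _)

theorem LD_lin3 (hU : IsOpen U) (hF : IsFinsler n U F)
    {T : Fin n → Fin n → Fin n → E n → E n → ℝ} (h : ∀ i j k, SF U (T i j k)) :
    ∀ m ∈ OmM U, L (DD (Gam n F)) (lin3 T) m = lin3 (Dyn3 n F T) m := by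
  intro m hm
  rw [L_lin3 hU h _ hm]
  set A : Fin n → Fin n → ℝ := fun a i => pdy n (Spray n F a) i m.1 m.2.1 with hA
  have hN : ∀ i, (DD (Gam n F) m).2.2 i = - ∑ l, A i l * m.2.2 l := by
    intro i
    have := N_eq hU hF hm i
    simp [DD, this, lin1, lift, hA]
  have hR : ∀ i j k, lift (Dyn3 n F T i j k) m = lift (Gop n F (T i j k)) m
      - (∑ l, A l i * lift (T l j k) m) - (∑ l, A l j * lift (T i l k) m)
      - ∑ l, A l k * lift (T i j l) m := fun i j k => rfl
  have g1 : ∑ i, ∑ j, ∑ k, (∑ l, A l i * lift (T l j k) m) * m.2.2 i * m.2.2 j * m.2.2 k =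
      ∑ i, ∑ j, ∑ k, lift (T i j k) m * (∑ l, A i l * m.2.2 l) * m.2.2 j * m.2.2 k := by
    simp only [Finset.mul_sum, Finset.sum_mul]
    rw [sum4]
    refine Finset.sum_congr rfl fun _ _ => Finset.sum_congr rfl fun _ _ =>
      Finset.sum_congr rfl fun _ _ => Finset.sum_congr rfl fun _ _ => ?_
    ring
  have g2 : ∑ i, ∑ j, ∑ k, (∑ l, A l j * lift (T i l k) m) * m.2.2 i * m.2.2 j * m.2.2 k =
      ∑ i, ∑ j, ∑ k, lift (T i j k) m * m.2.2 i * (∑ l, A j l * m.2.2 l) * m.2.2 k := by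
    refine Finset.sum_congr rfl fun i _ => ?_
    simp only [Finset.mul_sum, Finset.sum_mul]
    calc _ = ∑ k, ∑ j, ∑ l, A l j * lift (T i l k) m * m.2.2 i * m.2.2 j * m.2.2 k :=
            Finset.sum_comm
      _ = ∑ k, ∑ l, ∑ j, A l j * lift (T i l k) m * m.2.2 i * m.2.2 j * m.2.2 k :=
            Finset.sum_congr rfl fun _ _ => Finset.sum_comm
      _ = ∑ l, ∑ k, ∑ j, A l j * lift (T i l k) m * m.2.2 i * m.2.2 j * m.2.2 k :=
            Finset.sum_comm
      _ = _ := by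
            refine Finset.sum_congr rfl fun _ _ => Finset.sum_congr rfl fun _ _ =>
              Finset.sum_congr rfl fun _ _ => ?_
            ring
  have g3 : ∑ i, ∑ j, ∑ k, (∑ l, A l k * lift (T i j l) m) * m.2.2 i * m.2.2 j * m.2.2 k =
      ∑ i, ∑ j, ∑ k, lift (T i j k) m * m.2.2 i * m.2.2 j * (∑ l, A k l * m.2.2 l) := by
    refine Finset.sum_congr rfl fun i _ => Finset.sum_congr rfl fun j _ => ?_
    simp only [Finset.mul_sum, Finset.sum_mul]
    rw [Finset.sum_comm]
    refine Finset.sum_congr rfl fun _ _ => Finset.sum_congr rfl fun _ _ => ?_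
    ring
  simp only [lin3, LD_lift (h _ _ _) hU hm, hN, hR, sub_mul, Finset.sum_sub_distrib, g1, g2, g3,
    Finset.sum_add_distrib, mul_neg, neg_mul, Finset.sum_neg_distrib]
  ring

end calc_rules

section key

variable {n : ℕ} {U : Set (E n)} {F : E n → E n → ℝ}

theorem Cartan_12 (hU : IsOpen U) (hF : IsFinsler n U F) {x y : E n} (hx : x ∈ U)
    (hy : y ≠ 0) (i j k : Fin n) : Cartan n F i j k x y = Cartan n F j i k x y := by
  simp only [Cartan]
  rw [pdy_comm ((sf_F2 hF).pdy hU k) hU j i hx hy]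

theorem Cartan_23 (hU : IsOpen U) (hF : IsFinsler n U F) {x y : E n} (hx : x ∈ U)
    (hy : y ≠ 0) (i j k : Fin n) : Cartan n F i j k x y = Cartan n F i k j x y := by
  simp only [Cartan]
  rw [pdy_congr (fun x hx y hy => pdy_comm (sf_F2 hF) hU k j hx hy) i hx hy]

theorem Cartan_rot (hU : IsOpen U) (hF : IsFinsler n U F) {x y : E n} (hx : x ∈ U)
    (hy : y ≠ 0) (i j k : Fin n) : Cartan n F k i j x y = Cartan n F i j k x y := by
  rw [Cartan_12 hU hF hx hy k i j, Cartan_23 hU hF hx hy i k j]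

theorem pdy_gm (hU : IsOpen U) (hF : IsFinsler n U F) {x y : E n} (hx : x ∈ U)
    (hy : y ≠ 0) (i j k : Fin n) : pdy n (gm n F i j) k x y = 2 * Cartan n F i j k x y := by
  rw [← Cartan_rot hU hF hx hy]
  have h := (((sf_F2 hF).pdy hU j).pdy hU i).fdy hU hx hy
  have : pdy n (gm n F i j) k x y = fderiv ℝ (fun y =>
    (1 / 2 : ℝ) * pdy n (pdy n (F2 n F) j) i x y) y (e n k) := rfl
  rw [this, fderiv_const_mul h.differentiableAt]
  simp only [smul_apply, smul_eq_mul, Cartan]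
  rw [show fderiv ℝ (pdy n (pdy n (F2 n F) j) i x) y (e n k) =
    pdy n (pdy n (pdy n (F2 n F) j) i) k x y from rfl]
  ring

theorem Gop_F2 (hU : IsOpen U) (hF : IsFinsler n U F) {x y : E n} (hx : x ∈ U)
    (hy : y ≠ 0) : Gop n F (F2 n F) x y = 0 := by
  have h1 : 2 * ∑ i, Spray n F i x y * pdy n (F2 n F) i x y =
      ∑ l, y l * (4 * ∑ i, gm n F l i x y * Spray n F i x y) := by
    simp only [euler_F2y hU hF hx hy, Finset.mul_sum]
    rw [Finset.sum_comm]
    refine Finset.sum_congr rfl fun l _ => Finset.sum_congr rfl fun i _ => ?_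
    ring
  have h2 : ∑ l, y l * ∑ k, pdx n (pdy n (F2 n F) l) k x y * y k =
      ∑ k, 2 * (y k * pdx n (F2 n F) k x y) := by
    simp only [Finset.mul_sum]
    rw [Finset.sum_comm]
    refine Finset.sum_congr rfl fun k _ => ?_
    rw [mul_left_comm, ← euler_F2xy hU hF hx hy k, Finset.mul_sum]
    refine Finset.sum_congr rfl fun l _ => ?_
    ring
  simp only [Gop, h1, spray_eq hF hx hy, mul_sub, Finset.sum_sub_distrib, h2]
  rw [← Finset.mul_sum]
  ring

theorem Gop_F2y (hF : IsFinsler n U F) {x y : E n} (hx : x ∈ U)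
    (hy : y ≠ 0) (k : Fin n) : Gop n F (pdy n (F2 n F) k) x y = pdx n (F2 n F) k x y := by
  have h1 : 2 * ∑ j, Spray n F j x y * pdy n (pdy n (F2 n F) k) j x y =
      4 * ∑ i, gm n F k i x y * Spray n F i x y := by
    simp only [Finset.mul_sum]
    refine Finset.sum_congr rfl fun i _ => ?_
    rw [gm_symm hF hx hy k i]
    simp only [gm]; ring
  have h2 : ∑ j, y j * pdx n (pdy n (F2 n F) k) j x y =
      ∑ j, pdx n (pdy n (F2 n F) k) j x y * y j := Finset.sum_congr rfl fun _ _ => mul_comm _ _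
  simp only [Gop, h1, h2, spray_eq hF hx hy]
  ring

theorem ph1 (hU : IsOpen U) (hF : IsFinsler n U F) :
    ∀ m ∈ OmM U, L (VV n) (lift (F2 n F)) m = lin1 (pdy n (F2 n F)) m :=
  fun _ hm => LV_lift (sf_F2 hF) hU hm

theorem ph2 (hU : IsOpen U) (hF : IsFinsler n U F) :
    ∀ m ∈ OmM U, L (VV n) (L (VV n) (lift (F2 n F))) m =
      lin2 (fun i j => pdy n (pdy n (F2 n F) j) i) m := by
  intro m hm
  rw [L_congr (OmM_open hU) _ (ph1 hU hF) m hm,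
    LV_lin1 hU (fun i => (sf_F2 hF).pdy hU i) m hm]

theorem lin2_gm (m : M n) :
    lin2 (fun i j => pdy n (pdy n (F2 n F) j) i) m = 2 * lin2 (gm n F) m := by
  simp only [lin2, lift, gm, Finset.mul_sum]
  refine Finset.sum_congr rfl fun l _ => Finset.sum_congr rfl fun i _ => ?_
  ring

theorem ph3 (hU : IsOpen U) (hF : IsFinsler n U F) :
    ∀ m ∈ OmM U, L (VV n) (L (VV n) (L (VV n) (lift (F2 n F)))) m =
      4 * lin3 (Cartan n F) m := by
  intro m hm
  rw [L_congr (OmM_open hU) _ (ph2 hU hF) m hm,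
    LV_lin2 hU (fun i j => ((sf_F2 hF).pdy hU j).pdy hU i) m hm]
  simp only [lin3, lift, Cartan, Finset.mul_sum]
  refine Finset.sum_congr rfl fun l _ => Finset.sum_congr rfl fun i _ =>
    Finset.sum_congr rfl fun i _ => ?_
  ring

theorem L_const_mul {φ : M n → ℝ} (X : M n → M n) {m : M n} (h1 : DifferentiableAt ℝ φ m)
    (c : ℝ) : L X (fun m => c * φ m) m = c * L X φ m := by
  simp only [L]
  rw [fderiv_const_mul h1]
  simp

theorem sm_lin3 {f : Fin n → Fin n → Fin n → E n → E n → ℝ} (h : ∀ i j k, SF U (f i j k)) :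
    Sm (OmM U) (lin3 f) := by
  have h1 : ∀ i j k, ContDiffOn ℝ (⊤ : ℕ∞) (lift (f i j k)) (OmM U) :=
    fun i j k => sm_lift (h i j k)
  refine ContDiffOn.sum fun i _ => ContDiffOn.sum fun j _ => ContDiffOn.sum fun k _ => ?_
  have := h1 i j k
  fun_prop

theorem sm_lin2 {f : Fin n → Fin n → E n → E n → ℝ} (h : ∀ i j, SF U (f i j)) :
    Sm (OmM U) (lin2 f) := by
  have h1 : ∀ i j, ContDiffOn ℝ (⊤ : ℕ∞) (lift (f i j)) (OmM U) :=
    fun i j => sm_lift (h i j)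
  refine ContDiffOn.sum fun i _ => ContDiffOn.sum fun j _ => ?_
  have := h1 i j
  fun_prop

theorem main_id (hU : IsOpen U) (hF : IsFinsler n U F) {m : M n} (hm : m ∈ OmM U) :
    (∑ k, rho (Gam n F) m k * pdy n (F2 n F) k m.1 m.2.1 = 0) ∧
    lin3 (Dyn3 n F (Dyn3 n F (Cartan n F))) m =
      - (∑ i, ∑ j, ∑ k, lift (Cartan n F i j k) m * m.2.2 i * m.2.2 j * rho (Gam n F) m k)
      - ∑ i, ∑ j, lift (gm n F i j) m * m.2.2 i * L (VV n) (rho (Gam n F)) m j := by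
  have hs := OmM_open hU
  have hp := sf_F2 hF
  have hC := sf_Cartan hU hF
  have hDC := sf_Dyn3 hU hF hC
  have hφv : ∀ m ∈ OmM U, ∀ w : E n, fderiv ℝ (lift (F2 n F)) m (0, 0, w) = 0 := by
    intro m hm w
    rw [fd_lift hp hU hm]; simp
  have hD : ∀ m ∈ OmM U, L (DD (Gam n F)) (lift (F2 n F)) m = 0 := by
    intro m hm
    rw [LD_lift hp hU hm, lift, Gop_F2 hU hF hm.1 hm.2]
  have hDV : ∀ m ∈ OmM U, L (DD (Gam n F)) (L (VV n) (lift (F2 n F))) m =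
      L (HH (Gam n F)) (lift (F2 n F)) m := by
    intro m hm
    rw [L_congr hs _ (ph1 hU hF) m hm, L_lin1 hU (fun i => hp.pdy hU i) _ hm,
      L_lift hp hU _ hm, ← Finset.sum_add_distrib]
    refine Finset.sum_congr rfl fun k _ => ?_
    rw [LD_lift (hp.pdy hU k) hU hm]
    simp only [lift, Gop_F2y hF hm.1 hm.2, DD, HH]
    ring
  obtain ⟨r1, r2⟩ := main_abs hs (sm_Gam hU hF) (Gam_v hU hF) (sm_lift hp) hφv hD hDV hm
  refine ⟨?_, ?_⟩
  · rw [fd_lift hp hU hm] at r1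
    simpa using r1
  · set ρ := rho (Gam n F) m with hρ
    set lam := L (VV n) (rho (Gam n F)) m with hlam
    have a1 : L (DD (Gam n F)) (L (DD (Gam n F))
        (L (VV n) (L (VV n) (L (VV n) (lift (F2 n F)))))) m =
        4 * lin3 (Dyn3 n F (Dyn3 n F (Cartan n F))) m := by
      have b1 : ∀ m ∈ OmM U, L (DD (Gam n F))
        (L (VV n) (L (VV n) (L (VV n) (lift (F2 n F))))) m =
          4 * lin3 (Dyn3 n F (Cartan n F)) m := by
        intro m hm
        rw [L_congr hs _ (ph3 hU hF) m hm, L_const_mul _ ((sm_lin3 hC).diff hs hm),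
          LD_lin3 hU hF hC m hm]
      rw [L_congr hs _ b1 m hm, L_const_mul _ ((sm_lin3 hDC).diff hs hm),
          LD_lin3 hU hF hDC m hm]
    have a2 : fderiv ℝ (L (VV n) (L (VV n) (lift (F2 n F)))) m (0, ρ, lam) =
        2 * L (fun _ => (0, ρ, lam)) (lin2 (gm n F)) m := by
      have b2 : ∀ m ∈ OmM U, L (VV n) (L (VV n) (lift (F2 n F))) m = 2 * lin2 (gm n F) m :=
        fun m hm => by rw [ph2 hU hF m hm, lin2_gm]
      rw [← L_const_mul _ ((sm_lin2 (sf_gm hU hF)).diff hs hm),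
        ← L_congr hs (fun _ => (0, ρ, lam)) b2 m hm]
      rfl
    have a3 : L (fun _ => (0, ρ, lam)) (lin2 (gm n F)) m =
        2 * (∑ i, ∑ j, ∑ k, lift (Cartan n F i j k) m * m.2.2 i * m.2.2 j * ρ k)
        + 2 * ∑ i, ∑ j, lift (gm n F i j) m * m.2.2 i * lam j := by
      rw [L_lin2 hU (sf_gm hU hF) _ hm]
      simp only [Finset.sum_add_distrib]
      have c1 : ∑ i, ∑ j, lift (gm n F i j) m * lam i * m.2.2 j =
          ∑ i, ∑ j, lift (gm n F i j) m * m.2.2 i * lam j := by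
        rw [Finset.sum_comm]
        refine Finset.sum_congr rfl fun i _ => Finset.sum_congr rfl fun j _ => ?_
        simp only [lift]
        rw [gm_symm hF hm.1 hm.2]; ring
      have c2 : ∑ i, ∑ j, L (fun _ => (0, ρ, lam)) (lift (gm n F i j)) m * m.2.2 i * m.2.2 j =
          2 * (∑ i, ∑ j, ∑ k, lift (Cartan n F i j k) m * m.2.2 i * m.2.2 j * ρ k) := by
        simp only [Finset.mul_sum]
        refine Finset.sum_congr rfl fun i _ => Finset.sum_congr rfl fun j _ => ?_
        rw [L_lift (sf_gm hU hF i j) hU _ hm]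
        simp only [Pi.zero_apply, zero_mul, Finset.sum_const_zero, zero_add, Finset.sum_mul]
        refine Finset.sum_congr rfl fun k _ => ?_
        rw [pdy_gm hU hF hm.1 hm.2]
        simp only [lift]; ring
      rw [c1, c2]; ring
    rw [a1, a2, a3] at r2
    linarith

theorem Q_eq (hU : IsOpen U) (hF : IsFinsler n U F) : ∀ m ∈ OmM U, lin2 (Rlow n F) m =
    ∑ i, ∑ j, lift (gm n F i j) m * m.2.2 i * rho (Gam n F) m j := by
  intro m hm
  simp only [rho_eq hU hF hm, lin2, lin1, lift, Rlow, Finset.mul_sum, Finset.sum_mul]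
  refine Finset.sum_congr rfl fun i _ => ?_
  rw [Finset.sum_comm]
  refine Finset.sum_congr rfl fun j _ => Finset.sum_congr rfl fun k _ => ?_
  rw [gm_symm hF hm.1 hm.2]; ring

theorem LV_Q (hU : IsOpen U) (hF : IsFinsler n U F) {m : M n} (hm : m ∈ OmM U) :
    L (VV n) (lin2 (Rlow n F)) m =
      (∑ i, ∑ j, ∑ k, lift (Cartan n F i j k) m * m.2.2 i * m.2.2 j * rho (Gam n F) m k)
      - lin3 (Dyn3 n F (Dyn3 n F (Cartan n F))) m := by
  have hs := OmM_open hU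
  have hg := fun i j => (sm_lift (sf_gm hU hF i j)).diff hs hm
  have hr := (sm_rho hs (sm_Gam hU hF)).diff hs hm
  have hr' : ∀ j, DifferentiableAt ℝ (fun m => rho (Gam n F) m j) m :=
    fun j => differentiableAt_pi.1 hr j
  rw [(main_id hU hF hm).2, L_congr hs _ (Q_eq hU hF) m hm]
  rw [L_sum _ (fun i => by have := hg i; fun_prop)]
  have c1 : ∀ i j k : Fin n, lift (Cartan n F i j k) m = lift (Cartan n F i k j) m :=
    fun i j k => Cartan_23 hU hF hm.1 hm.2 i j k
  have h1 : ∀ i, L (VV n) (fun m => ∑ j, lift (gm n F i j) m * m.2.2 i * rho (Gam n F) m j) m =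
      2 * (∑ j, ∑ k, lift (Cartan n F i j k) m * m.2.2 i * m.2.2 j * rho (Gam n F) m k) +
      ∑ j, lift (gm n F i j) m * m.2.2 i * L (VV n) (rho (Gam n F)) m j := by
    intro i
    rw [L_sum _ (fun j => by have := hg i j; fun_prop), Finset.sum_comm, Finset.mul_sum,
      ← Finset.sum_add_distrib]
    refine Finset.sum_congr rfl fun j _ => ?_
    have := hg i j
    rw [L_mul _ (by fun_prop) (hr' j), L_mul _ (by fun_prop) (by fun_prop), L_vco,
      LV_lift (sf_gm hU hF i j) hU hm, L_pi _ hr]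
    simp only [VV, Pi.zero_apply, mul_zero, add_zero]
    congr 1
    rw [Finset.sum_mul, Finset.sum_mul, Finset.mul_sum]
    refine Finset.sum_congr rfl fun k _ => ?_
    have := pdy_gm hU hF hm.1 hm.2 i j k
    rw [c1 i k j]
    simp only [lift, this]
    ring
  simp only [h1, Finset.sum_add_distrib]
  rw [← Finset.mul_sum]
  ring

theorem pdy_F2 (hU : IsOpen U) (hF : IsFinsler n U F) {x y : E n} (hx : x ∈ U)
    (hy : y ≠ 0) (i : Fin n) : pdy n (F2 n F) i x y = 2 * F x y * Fy n F i x y := by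
  have h := ((sf_F hF).fdy hU hx hy).differentiableAt
  simp only [pdy, Fy]
  have : F2 n F x = fun y => F x y ^ 2 := rfl
  rw [this, fderiv_fun_pow 2 h]
  simp

/-- The denominator of the flag curvature. -/
def WW (n : ℕ) (F : E n → E n → ℝ) : M n → ℝ := fun m => lift (F2 n F) m * lin2 (hm n F) m

theorem WW_eq (hU : IsOpen U) (hF : IsFinsler n U F) : ∀ m ∈ OmM U, WW n F m =
    (1 / 2) * (lift (F2 n F) m * L (VV n) (L (VV n) (lift (F2 n F))) m)
    - (1 / 4) * (L (VV n) (lift (F2 n F)) m * L (VV n) (lift (F2 n F)) m) := by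
  intro m hm
  rw [ph2 hU hF m hm, lin2_gm, ph1 hU hF m hm]
  have h1 : lin1 (pdy n (F2 n F)) m = 2 * F m.1 m.2.1 * lin1 (Fy n F) m := by
    simp only [lin1, lift, pdy_F2 hU hF hm.1 hm.2, Finset.mul_sum]
    refine Finset.sum_congr rfl fun k _ => ?_
    ring
  have h2 : lin2 (Paper.hm n F) m = lin2 (gm n F) m - lin1 (Fy n F) m * lin1 (Fy n F) m := by
    simp only [lin2, lin1, lift, Paper.hm, Finset.sum_mul_sum, ← Finset.sum_sub_distrib]
    refine Finset.sum_congr rfl fun k _ => Finset.sum_congr rfl fun j _ => ?_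
    ring
  rw [WW, h1, h2, lift, F2]
  ring

theorem LV_WW (hU : IsOpen U) (hF : IsFinsler n U F) {m : M n} (hm : m ∈ OmM U) :
    L (VV n) (WW n F) m = 2 * lift (F2 n F) m * lin3 (Cartan n F) m := by
  have hs := OmM_open hU
  have s0 := sm_lift (sf_F2 hF)
  have s1 : Sm (OmM U) (L (VV n) (lift (F2 n F))) := s0.L sm_VV hs
  have s2 : Sm (OmM U) (L (VV n) (L (VV n) (lift (F2 n F)))) := s1.L sm_VV hs
  have d0 := s0.diff hs hm
  have d1 := s1.diff hs hm
  have d2 := s2.diff hs hm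
  rw [L_congr hs _ (WW_eq hU hF) m hm]
  have : ∀ φ ψ : M n → ℝ, DifferentiableAt ℝ φ m → DifferentiableAt ℝ ψ m →
      L (VV n) (fun m => φ m - ψ m) m = L (VV n) φ m - L (VV n) ψ m := by
    intro φ ψ h1 h2
    simp only [L]; rw [fderiv_fun_sub h1 h2]; rfl
  rw [this _ _ (by fun_prop) (by fun_prop), L_const_mul _ (by fun_prop),
    L_const_mul _ (by fun_prop), L_mul _ d0 d2, L_mul _ d1 d1, ph3 hU hF m hm]
  ring

theorem rho_y (hU : IsOpen U) (hF : IsFinsler n U F) {x y : E n} (hx : x ∈ U)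
    (hy : y ≠ 0) : rho (Gam n F) (x, y, y) = 0 := by
  have hs := OmM_open hU
  have hG := sm_Gam hU hF
  have hN : Sm (OmM U) (L (VV n) (Gam n F)) := hG.L sm_VV hs
  let τ : M n →L[ℝ] M n := (ContinuousLinearMap.fst ℝ (E n) (E n × E n)).prod
    (((ContinuousLinearMap.fst ℝ (E n) (E n)).comp
      (ContinuousLinearMap.snd ℝ (E n) (E n × E n))).prod
        ((ContinuousLinearMap.fst ℝ (E n) (E n)).comp
          (ContinuousLinearMap.snd ℝ (E n) (E n × E n))))
  have hτ : ∀ m : M n, τ m = (m.1, m.2.1, m.2.1) := fun m => rfl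
  have hE : ∀ m ∈ OmM U, L (VV n) (Gam n F) (τ m) = (2 : ℝ) • Gam n F m := by
    intro m hm
    ext i
    have hm' : τ m ∈ OmM U := hm
    rw [N_eq hU hF hm']
    have := (hom_Spray hU hF i).euler hU (sf_Spray hU hF i) hm.1 hm.2
    simp only [lin1, lift, hτ, Gam, Pi.smul_apply, smul_eq_mul]
    rw [Nat.cast_ofNat] at this
    rw [← this]
    exact Finset.sum_congr rfl fun _ _ => mul_comm _ _
  set m : M n := (x, y, y)
  have hm : m ∈ OmM U := ⟨hx, hy⟩
  have hτm : τ m = m := rfl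
  have hm1 : m.2.1 = y := rfl
  have hm2 : m.2.2 = y := rfl
  have hNm : L (VV n) (Gam n F) m = (2 : ℝ) • Gam n F m := by
    have := hE m hm; rwa [hτm] at this
  set w : M n := (y, - ((2 : ℝ) • Gam n F m), 0) with hw
  have h1 : fderiv ℝ (fun m => L (VV n) (Gam n F) (τ m)) m w =
      fderiv ℝ (fun m => (2 : ℝ) • Gam n F m) m w := by
    have : (fun m => L (VV n) (Gam n F) (τ m)) =ᶠ[nhds m] (fun m => (2 : ℝ) • Gam n F m) :=
      Filter.eventually_of_mem (hs.mem_nhds hm) hE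
    rw [this.fderiv_eq]
  have h2 : fderiv ℝ (fun m => L (VV n) (Gam n F) (τ m)) m w =
      L (DD (Gam n F)) (L (VV n) (Gam n F)) m := by
    have a : HasFDerivAt (L (VV n) (Gam n F)) (fderiv ℝ (L (VV n) (Gam n F)) m) (τ m) :=
      (hN.diff hs hm).hasFDerivAt
    have b := a.comp m τ.hasFDerivAt
    have c : fderiv ℝ (fun m => L (VV n) (Gam n F) (τ m)) m = _ := b.fderiv
    rw [c, L]
    change fderiv ℝ (L (VV n) (Gam n F)) m (τ w) = _
    congr 1
    simp only [hτ, hw, DD, hNm, hm1, neg_smul]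
  have h3 : L (HH (Gam n F)) (Gam n F) m = fderiv ℝ (Gam n F) m w := by
    have : HH (Gam n F) m = w + (0, 0, - L (VV n) (L (VV n) (Gam n F)) m) := by
      simp [HH, hw, hNm, hm2]
    rw [L, this, map_add, Gam_v hU hF m hm, add_zero]
  rw [rho, h3, ← h2, h1, fderiv_fun_const_smul (hG.diff hs hm)]
  simp

end key

section final

variable {n : ℕ} {U : Set (E n)} {F : E n → E n → ℝ}

/-- A bilinear form given by a matrix. -/
def bil (A : Fin n → Fin n → ℝ) (u w : E n) : ℝ := ∑ i, ∑ j, A i j * u i * w j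

theorem bil_left (A : Fin n → Fin n → ℝ) (a c : ℝ) (u v w : E n) :
    bil A (a • u + c • v) w = a * bil A u w + c * bil A v w := by
  simp only [bil, Finset.mul_sum, ← Finset.sum_add_distrib]
  refine Finset.sum_congr rfl fun i _ => Finset.sum_congr rfl fun j _ => ?_
  simp; ring

theorem bil_right (A : Fin n → Fin n → ℝ) (a c : ℝ) (u v w : E n) :
    bil A w (a • u + c • v) = a * bil A w u + c * bil A w v := by
  simp only [bil, Finset.mul_sum, ← Finset.sum_add_distrib]
  refine Finset.sum_congr rfl fun i _ => Finset.sum_congr rfl fun j _ => ?_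
  simp; ring

/-- The metric at `(x, y)`. -/
def gb (n : ℕ) (F : E n → E n → ℝ) (x y : E n) : E n → E n → ℝ :=
  bil (fun i j => gm n F i j x y)

theorem gb_symm (hF : IsFinsler n U F) {x y : E n} (hx : x ∈ U) (hy : y ≠ 0) (u w : E n) :
    gb n F x y u w = gb n F x y w u := by
  simp only [gb, bil]
  rw [Finset.sum_comm]
  refine Finset.sum_congr rfl fun i _ => Finset.sum_congr rfl fun j _ => ?_
  rw [gm_symm hF hx hy]; ring

theorem gb_y (hU : IsOpen U) (hF : IsFinsler n U F) {x y : E n} (hx : x ∈ U) (hy : y ≠ 0)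
    (w : E n) : 2 * gb n F x y y w = ∑ j, w j * pdy n (F2 n F) j x y := by
  simp only [gb, bil, euler_F2y hU hF hx hy, Finset.mul_sum]
  rw [Finset.sum_comm]
  refine Finset.sum_congr rfl fun i _ => Finset.sum_congr rfl fun j _ => ?_
  ring

theorem gb_yy (hU : IsOpen U) (hF : IsFinsler n U F) {x y : E n} (hx : x ∈ U) (hy : y ≠ 0) :
    gb n F x y y y = F2 n F x y := by
  have h1 := gb_y hU hF hx hy y
  rw [(hom_F2 hF).euler hU (sf_F2 hF) hx hy] at h1
  push_cast at h1
  linarith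

theorem gb_pos (hF : IsFinsler n U F) {x y : E n} (hx : x ∈ U) (hy : y ≠ 0)
    {z : E n} (hz : z ≠ 0) : 0 < gb n F x y z z := by
  have := (hF.posdef x hx y hy).dotProduct_mulVec_pos hz
  have e1 : star z ⬝ᵥ (gmat n F x y).mulVec z = gb n F x y z z := by
    simp only [gb, bil, dotProduct, Matrix.mulVec, gmat, Matrix.of_apply, Finset.mul_sum]
    refine Finset.sum_congr rfl fun i _ => Finset.sum_congr rfl fun j _ => ?_
    simp; ring
  rwa [e1] at this

theorem F2_pos (hF : IsFinsler n U F) {x y : E n} (hx : x ∈ U) (hy : y ≠ 0) :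
    0 < F2 n F x y := pow_pos (hF.pos x hx y hy) 2

theorem WW_gb (hU : IsOpen U) (hF : IsFinsler n U F) {x y : E n} (hx : x ∈ U) (hy : y ≠ 0)
    (v : E n) : WW n F (x, y, v) =
      F2 n F x y * gb n F x y v v - gb n F x y y v * gb n F x y y v := by
  have hm : ((x, y, v) : M n) ∈ OmM U := ⟨hx, hy⟩
  rw [WW_eq hU hF _ hm, ph2 hU hF _ hm, lin2_gm, ph1 hU hF _ hm]
  have h1 : lin1 (pdy n (F2 n F)) (x, y, v) = 2 * gb n F x y y v := by
    rw [gb_y hU hF hx hy]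
    exact Finset.sum_congr rfl fun _ _ => mul_comm _ _
  have h2 : lin2 (gm n F) (x, y, v) = gb n F x y v v := rfl
  rw [h1, h2, lift]
  ring

theorem WW_inv (hU : IsOpen U) (hF : IsFinsler n U F) {x y : E n} (hx : x ∈ U) (hy : y ≠ 0)
    (v : E n) (a c : ℝ) : WW n F (x, y, a • v + c • y) = a ^ 2 * WW n F (x, y, v) := by
  rw [WW_gb hU hF hx hy, WW_gb hU hF hx hy]
  have h := gb_symm hF hx hy v y
  have h2 := gb_yy hU hF hx hy
  simp only [gb] at *
  simp only [bil_left, bil_right, h, h2]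
  ring

theorem indep_ne {y v : E n} (h : LinearIndependent ℝ ![y, v]) : y ≠ 0 := by
  simpa using h.ne_zero 0

theorem WW_pos (hU : IsOpen U) (hF : IsFinsler n U F) {x y v : E n} (hx : x ∈ U)
    (h : LinearIndependent ℝ ![y, v]) : 0 < WW n F (x, y, v) := by
  have hy := indep_ne h
  have hp := F2_pos hF hx hy
  have hz : F2 n F x y • v + (- gb n F x y y v) • y ≠ 0 := by
    intro h0
    rw [LinearIndependent.pair_iff] at h
    have := (h _ _ ((add_comm _ _).trans h0)).2
    exact hp.ne' this
  have h3 := gb_pos hF hx hy hz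
  have h1 := gb_symm hF hx hy v y
  have h2 := gb_yy hU hF hx hy
  rw [WW_gb hU hF hx hy]
  simp only [gb] at *
  simp only [bil_left, bil_right, h1, h2] at h3
  nlinarith

theorem Q_inv (hU : IsOpen U) (hF : IsFinsler n U F) {x y : E n} (hx : x ∈ U) (hy : y ≠ 0)
    (v : E n) (a c : ℝ) : lin2 (Rlow n F) (x, y, a • v + c • y) =
      a ^ 2 * lin2 (Rlow n F) (x, y, v) := by
  have hR : ∀ u w : E n, bil (fun i j => Rlow n F i j x y) u w =
      gb n F x y u (rho (Gam n F) (x, y, w)) := by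
    intro u w
    have hm : ((x, y, w) : M n) ∈ OmM U := ⟨hx, hy⟩
    simp only [gb, bil, rho_eq hU hF hm, lin1, lift, Rlow, Finset.mul_sum, Finset.sum_mul]
    refine Finset.sum_congr rfl fun i _ => ?_
    rw [Finset.sum_comm]
    refine Finset.sum_congr rfl fun j _ => Finset.sum_congr rfl fun k _ => ?_
    rw [gm_symm hF hx hy]; ring
  have h1 : ∀ w, bil (fun i j => Rlow n F i j x y) y w = 0 := by
    intro w
    have hm : ((x, y, w) : M n) ∈ OmM U := ⟨hx, hy⟩
    have a1 := gb_y hU hF hx hy (rho (Gam n F) (x, y, w))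
    rw [(main_id hU hF hm).1] at a1
    rw [hR]; linarith
  have h2 : ∀ u, bil (fun i j => Rlow n F i j x y) u y = 0 := by
    intro u
    rw [hR, rho_y hU hF hx hy]
    simp [gb, bil]
  have h3 : ∀ u, lin2 (Rlow n F) (x, y, u) = bil (fun i j => Rlow n F i j x y) u u :=
    fun u => rfl
  rw [h3, h3]
  simp only [bil_left, bil_right, h1, h2]
  ring

theorem K_eq (x y v : E n) : K n F x y v = lin2 (Rlow n F) (x, y, v) / WW n F (x, y, v) := rfl

theorem K_inv (hU : IsOpen U) (hF : IsFinsler n U F) {x y : E n} (hx : x ∈ U) (hy : y ≠ 0)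
    (v : E n) {a : ℝ} (ha : a ≠ 0) (c : ℝ) : K n F x y (a • v + c • y) = K n F x y v := by
  rw [K_eq, K_eq, Q_inv hU hF hx hy, WW_inv hU hF hx hy]
  exact mul_div_mul_left _ _ (pow_ne_zero 2 ha)

theorem sm_Q (hU : IsOpen U) (hF : IsFinsler n U F) : Sm (OmM U) (lin2 (Rlow n F)) := by
  refine ContDiffOn.congr ?_ (Q_eq hU hF)
  have hr : ContDiffOn ℝ (⊤ : ℕ∞) (rho (Gam n F)) (OmM U) :=
    sm_rho (OmM_open hU) (sm_Gam hU hF)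
  refine ContDiffOn.sum fun i _ => ContDiffOn.sum fun j _ => ?_
  have h1 : ContDiffOn ℝ (⊤ : ℕ∞) (lift (gm n F i j)) (OmM U) := sm_lift (sf_gm hU hF i j)
  have h2 := contDiffOn_pi.1 hr j
  exact (h1.mul (by fun_prop)).mul h2

theorem sm_WW (hU : IsOpen U) (hF : IsFinsler n U F) : Sm (OmM U) (WW n F) := by
  have hs := OmM_open hU
  have s0 := sm_lift (sf_F2 hF)
  have s1 : Sm (OmM U) (L (VV n) (lift (F2 n F))) := s0.L sm_VV hs
  have s2 : Sm (OmM U) (L (VV n) (L (VV n) (lift (F2 n F)))) := s1.L sm_VV hs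
  unfold Sm at *
  refine ContDiffOn.congr ?_ (WW_eq hU hF)
  fun_prop

theorem deriv_line {φ : M n → ℝ} {x y v : E n} {t : ℝ}
    (h : DifferentiableAt ℝ φ (x, y + t • v, v)) :
    HasDerivAt (fun t : ℝ => φ (x, y + t • v, v)) (L (VV n) φ (x, y + t • v, v)) t := by
  have h1 : HasDerivAt (fun t : ℝ => ((x, y + t • v, v) : M n)) ((0, v, 0) : M n) t := by
    refine (hasDerivAt_const t x).prodMk (HasDerivAt.prodMk ?_ (hasDerivAt_const t v))
    simpa using ((hasDerivAt_id t).smul_const v).const_add y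
  exact h.hasFDerivAt.comp_hasDerivAt t h1

theorem deriv_K (hU : IsOpen U) (hF : IsFinsler n U F) {x y v : E n} {t : ℝ} (hx : x ∈ U)
    (h : LinearIndependent ℝ ![y + t • v, v]) :
    HasDerivAt (fun t : ℝ => K n F x (y + t • v) v)
      (F2 n F x (y + t • v) * (L (VV n) (lin2 (Rlow n F)) (x, y + t • v, v) *
          lin2 (hm n F) (x, y + t • v, v) -
        2 * lin3 (Cartan n F) (x, y + t • v, v) * lin2 (Rlow n F) (x, y + t • v, v)) /
        WW n F (x, y + t • v, v) ^ 2) t := by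
  have hs := OmM_open hU
  have hm : ((x, y + t • v, v) : M n) ∈ OmM U := ⟨hx, indep_ne h⟩
  have h1 := deriv_line ((sm_Q hU hF).diff hs hm)
  have h2 := deriv_line ((sm_WW hU hF).diff hs hm)
  have h3 := h1.div h2 (WW_pos hU hF hx h).ne'
  rw [LV_WW hU hF hm] at h3
  refine HasDerivAt.congr_deriv h3 ?_
  congr 1
  simp only [WW, lift]
  ring

theorem indep_add {y v : E n} (t : ℝ) (h : LinearIndependent ℝ ![y, v]) :
    LinearIndependent ℝ ![y + t • v, v] := by
  rw [LinearIndependent.pair_iff] at *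
  intro a b hab
  have := h a (a * t + b) (by rw [← hab]; module)
  obtain ⟨rfl, h2⟩ := this
  simpa using h2

theorem ident_iff (hU : IsOpen U) (hF : IsFinsler n U F) {x y : E n} (hx : x ∈ U)
    (hy : y ≠ 0) (v : E n) :
    (((∑ i, ∑ j, ∑ m, Cartan n F i j m x y * v i * v j *
            (∑ k, RiemUp n F m k x y * v k)) -
          ∑ i, ∑ j, ∑ k, Dyn3 n F (Dyn3 n F (Cartan n F)) i j k x y * v i * v j * v k) *
          (∑ p, ∑ q, hm n F p q x y * v p * v q) =
        2 * (∑ i, ∑ j, ∑ k, Cartan n F i j k x y * v i * v j * v k) *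
          (∑ p, ∑ q, Rlow n F p q x y * v p * v q)) ↔
    L (VV n) (lin2 (Rlow n F)) (x, y, v) * lin2 (hm n F) (x, y, v) =
      2 * lin3 (Cartan n F) (x, y, v) * lin2 (Rlow n F) (x, y, v) := by
  have hm : ((x, y, v) : M n) ∈ OmM U := ⟨hx, hy⟩
  rw [LV_Q hU hF hm]
  simp only [rho_eq hU hF hm]
  rfl

theorem forward (hU : IsOpen U) (hF : IsFinsler n U F) (hS : SectionalFlagCurv n U F)
    {x y : E n} (hx : x ∈ U) (hy : y ≠ 0) (v : E n) :
    L (VV n) (lin2 (Rlow n F)) (x, y, v) * lin2 (hm n F) (x, y, v) =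
      2 * lin3 (Cartan n F) (x, y, v) * lin2 (Rlow n F) (x, y, v) := by
  by_cases h : LinearIndependent ℝ ![y, v]
  · have h0 : LinearIndependent ℝ ![y + (0 : ℝ) • v, v] := by simpa using h
    have h1 := deriv_K hU hF hx h0
    have h2 : (fun t : ℝ => K n F x (y + t • v) v) = fun _ => K n F x y v := by
      funext t
      refine hS x hx _ _ _ _ (indep_add t h) h ?_
      apply le_antisymm <;> rw [Submodule.span_le] <;> rintro z (rfl | rfl) <;>
        rw [SetLike.mem_coe, Submodule.mem_span_pair]
      · exact ⟨1, t, by module⟩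
      · exact ⟨0, 1, by module⟩
      · exact ⟨1, -t, by module⟩
      · exact ⟨0, 1, by module⟩
    rw [h2] at h1
    have h3 := h1.unique (hasDerivAt_const (0 : ℝ) (K n F x y v))
    simp only [zero_smul, add_zero] at h3
    rw [div_eq_zero_iff] at h3
    rcases h3 with h3 | h3
    · rcases mul_eq_zero.1 h3 with h4 | h4
      · exact absurd h4 (F2_pos hF hx hy).ne'
      · linarith
    · exact absurd h3 (pow_ne_zero 2 (WW_pos hU hF hx h).ne')
  · rw [LinearIndependent.pair_iff' hy] at h
    push Not at h
    obtain ⟨c, hc⟩ := h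
    have e1 : v = (0 : ℝ) • (0 : E n) + c • y := by rw [← hc]; module
    have h1 := Q_inv hU hF hx hy 0 0 c
    have h2 := WW_inv hU hF hx hy 0 0 c
    rw [← e1] at h1 h2
    have h3 : lin2 (hm n F) (x, y, v) = 0 := by
      rw [WW] at h2
      have := (F2_pos hF hx hy).ne'
      simp only [lift] at h2
      rw [zero_pow two_ne_zero, zero_mul] at h2
      exact (mul_eq_zero.1 h2).resolve_left this
    rw [h3, h1]; ring

theorem step0 (hU : IsOpen U) (hF : IsFinsler n U F) {x y v w : E n} (hx : x ∈ U)
    (h : LinearIndependent ℝ ![y, w]) (hw : w ∈ Submodule.span ℝ {y, v}) :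
    K n F x y v = K n F x y w := by
  obtain ⟨c, a, rfl⟩ := Submodule.mem_span_pair.1 hw
  have ha : a ≠ 0 := by
    rintro rfl
    rw [LinearIndependent.pair_iff] at h
    have := (h (-c) 1 (by module)).2
    exact one_ne_zero this
  rw [add_comm, K_inv hU hF hx (indep_ne h) v ha]

theorem step1 (hU : IsOpen U) (hF : IsFinsler n U F)
    (hI : ∀ x ∈ U, ∀ y : E n, y ≠ 0 → ∀ v : E n,
      L (VV n) (lin2 (Rlow n F)) (x, y, v) * lin2 (hm n F) (x, y, v) =
      2 * lin3 (Cartan n F) (x, y, v) * lin2 (Rlow n F) (x, y, v)) {x y v : E n} (hx : x ∈ U)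
    (h : LinearIndependent ℝ ![y, v]) : K n F x y v = K n F x (y + v) v := by
  have h1 : ∀ t : ℝ, HasDerivAt (fun t : ℝ => K n F x (y + t • v) v) 0 t := by
    intro t
    have ht := indep_add t h
    have := deriv_K hU hF hx ht
    rwa [hI x hx _ (indep_ne ht) v, sub_self, mul_zero, zero_div] at this
  have := is_const_of_deriv_eq_zero (fun t => (h1 t).differentiableAt)
    (fun t => (h1 t).deriv) 0 1
  simpa using this

theorem step2 (hU : IsOpen U) (hF : IsFinsler n U F)
    (hI : ∀ x ∈ U, ∀ y : E n, y ≠ 0 → ∀ v : E n,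
      L (VV n) (lin2 (Rlow n F)) (x, y, v) * lin2 (hm n F) (x, y, v) =
      2 * lin3 (Cartan n F) (x, y, v) * lin2 (Rlow n F) (x, y, v))
    {x y v y' v' : E n} (hx : x ∈ U) (h : LinearIndependent ℝ ![y, y'])
    (hs : Submodule.span ℝ {y, v} = Submodule.span ℝ {y', v'}) :
    K n F x y v = K n F x y' v' := by
  have hy : y ∈ Submodule.span ℝ {y, v} := Submodule.subset_span (by simp)
  have hy' : y' ∈ Submodule.span ℝ {y, v} := by
    rw [hs]; exact Submodule.subset_span (by simp)
  have hw : y' - y ∈ Submodule.span ℝ {y, v} := Submodule.sub_mem _ hy' hy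
  have i1 : LinearIndependent ℝ ![y, y' - y] := by
    rw [LinearIndependent.pair_iff] at *
    intro a b hab
    have := h (a - b) b (by rw [← hab]; module)
    obtain ⟨h1, rfl⟩ := this
    simpa using h1
  have i2 := indep_add 1 i1
  rw [one_smul, add_sub_cancel] at i2
  rw [step0 hU hF hx i1 hw, step1 hU hF hI hx i1, add_sub_cancel]
  exact (step0 hU hF hx i2 (hs ▸ hw)).symm

theorem backward (hU : IsOpen U) (hF : IsFinsler n U F)
    (hI : ∀ x ∈ U, ∀ y : E n, y ≠ 0 → ∀ v : E n,
      L (VV n) (lin2 (Rlow n F)) (x, y, v) * lin2 (hm n F) (x, y, v) =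
      2 * lin3 (Cartan n F) (x, y, v) * lin2 (Rlow n F) (x, y, v)) :
    SectionalFlagCurv n U F := by
  intro x hx y v y' v' h h' hs
  by_cases hyy : LinearIndependent ℝ ![y, y']
  · exact step2 hU hF hI hx hyy hs
  · rw [LinearIndependent.pair_iff' (indep_ne h)] at hyy
    push Not at hyy
    obtain ⟨c, hc⟩ := hyy
    have hc0 : c ≠ 0 := by
      rintro rfl
      exact indep_ne h' (by rw [← hc, zero_smul])
    have hs' : Submodule.span ℝ {y, v} = Submodule.span ℝ {v, y} := by rw [Set.pair_comm]
    have i : LinearIndependent ℝ ![v, y'] := by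
      rw [LinearIndependent.pair_iff] at *
      intro a b hab
      have := h (b * c) a (by rw [← hab, ← hc]; module)
      refine ⟨this.2, ?_⟩
      simpa [hc0] using this.1
    rw [step2 hU hF hI hx h hs', step2 hU hF hI hx i (hs'.symm.trans hs)]

end final

/-- A Finsler metric is of sectional flag curvature iff the identity
`(C_{ijm}v^iv^jR^m_kv^k - C_{ijk|0|0}v^iv^jv^k)·h_{pq}v^pv^q = 2 C_{ijk}v^iv^jv^k · R_{pq}v^pv^q`
holds for all `x ∈ U`, `y ≠ 0`, `v`. -/
theorem sectional_flag_curvature_iff (n : ℕ) (hn : 2 ≤ n)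
    (U : Set (E n)) (hU : IsOpen U) (F : E n → E n → ℝ)
    (hF : IsFinsler n U F) :
    SectionalFlagCurv n U F ↔
      ∀ x ∈ U, ∀ y : E n, y ≠ 0 → ∀ v : E n,
        ((∑ i, ∑ j, ∑ m, Cartan n F i j m x y * v i * v j *
            (∑ k, RiemUp n F m k x y * v k)) -
          ∑ i, ∑ j, ∑ k, Dyn3 n F (Dyn3 n F (Cartan n F)) i j k x y * v i * v j * v k) *
          (∑ p, ∑ q, hm n F p q x y * v p * v q) =
        2 * (∑ i, ∑ j, ∑ k, Cartan n F i j k x y * v i * v j * v k) *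
          (∑ p, ∑ q, Rlow n F p q x y * v p * v q) := by
  constructor
  · intro hS x hx y hy v
    exact (ident_iff hU hF hx hy v).2 (forward hU hF hS hx hy v)
  · intro hI
    exact backward hU hF fun x hx y hy v => (ident_iff hU hF hx hy v).1 (hI x hx y hy v)

end Paper
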